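/- arXiv:1504.02986 — 4 statements merged into one kernel-verified Lean document; each statement's English description precedes it below -/
import Mathlib

section
/- (Porosity in many scales.) For every ρ ∈ (0,1), C ≥ 1 and ε ∈ (0,1) there exist σ ∈ (0,1) and C₁ > 0 with the following property. Let r > 0, let n be a natural number, and let X be a measurable subset of the open disk D_r = {z ∈ ℂ : |z| < r}. Assume that for every z ∈ X there exist natural numbers l_1 < l_2 < … < l_n and radii r_1, …, r_n with C⁻¹ ρ^{l_k} ≤ r_k / r ≤ C ρ^{l_k} for each k, such that each disk D(z, r_k) contains a gap in X of radius ε·r_k (that is, an open round disk of radius ε·r_k contained in D(z, r_k) and disjoint from X). Then area(X) ≤ C₁ · σⁿ · r². -/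
open MeasureTheory Metric

lemma pms_vol (x : ℂ) {t : ℝ} (ht : 0 ≤ t) :
    volume (closedBall x t) = ENNReal.ofReal (Real.pi * t ^ 2) := by
  rw [Complex.volume_closedBall, mul_comm, ENNReal.ofReal_mul Real.pi_pos.le,
    ENNReal.ofReal_pow ht]
  congr 1
  rw [← NNReal.coe_real_pi, ENNReal.ofReal_coe_nnreal]

lemma pms_vol' (x : ℂ) {t : ℝ} (ht : 0 ≤ t) :
    volume (ball x t) = ENNReal.ofReal (Real.pi * t ^ 2) := by
  rw [Complex.volume_ball, mul_comm, ENNReal.ofReal_mul Real.pi_pos.le,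
    ENNReal.ofReal_pow ht]
  congr 1
  rw [← NNReal.coe_real_pi, ENNReal.ofReal_coe_nnreal]

/-- Weak type (1,1) estimate. -/
lemma pms_weak (X P : Set ℂ) (R : ℂ → ℝ) (R0 : ℝ) (hX : MeasurableSet X)
    (hR : ∀ x ∈ P, 0 < R x ∧ R x ≤ R0) (s : ENNReal)
    (h : ∀ x ∈ P, s * ENNReal.ofReal (R x ^ 2) ≤ volume (closedBall x (R x) ∩ X)) :
    s * volume P ≤ ENNReal.ofReal (16 * Real.pi) * volume X := by
  obtain ⟨u, huP, hdis, hcov⟩ :=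
    Vitali.exists_disjoint_subfamily_covering_enlargement_closedBall P (fun x => x) R R0
      (fun a ha => (hR a ha).2) 4 (by norm_num)
  have huc : u.Countable := by
    apply hdis.countable_of_nonempty_interior
    intro a ha
    refine ⟨a, ?_⟩
    exact ball_subset_interior_closedBall (mem_ball_self (hR a (huP ha)).1)
  have hsub : P ⊆ ⋃ b ∈ u, closedBall b (4 * R b) := by
    intro a ha
    obtain ⟨b, hb, hab⟩ := hcov a ha
    exact Set.mem_biUnion hb (hab (mem_closedBall_self (hR a ha).1.le))
  have := huc.to_subtype
  have h1 : volume P ≤ ∑' b : u, volume (closedBall (b : ℂ) (4 * R b)) :=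
    (measure_mono hsub).trans (measure_biUnion_le _ huc _)
  have h2 : ∑' b : u, volume (closedBall (b : ℂ) (R b) ∩ X) ≤ volume X := by
    rw [← measure_biUnion huc (f := fun b => closedBall b (R b) ∩ X)]
    · exact measure_mono (by intro x; simp)
    · intro a ha b hb hab
      exact (hdis ha hb hab).mono Set.inter_subset_left Set.inter_subset_left
    · intro b _
      exact isClosed_closedBall.measurableSet.inter hX
  calc s * volume P ≤ s * ∑' b : u, volume (closedBall (b : ℂ) (4 * R b)) := by gcongr
    _ = ∑' b : u, s * volume (closedBall (b : ℂ) (4 * R b)) := ENNReal.tsum_mul_left.symm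
    _ ≤ ∑' b : u, ENNReal.ofReal (16 * Real.pi) * volume (closedBall (b : ℂ) (R b) ∩ X) := by
        apply ENNReal.tsum_le_tsum
        intro b
        have hb := huP b.2
        have h0 := (hR b hb).1
        rw [pms_vol _ (by positivity), show Real.pi * (4 * R b) ^ 2 = (16 * Real.pi) * (R b) ^ 2 by ring,
          ENNReal.ofReal_mul (by positivity), mul_left_comm]
        gcongr
        exact h b hb
    _ = ENNReal.ofReal (16 * Real.pi) * ∑' b : u, volume (closedBall (b : ℂ) (R b) ∩ X) :=
        ENNReal.tsum_mul_left
    _ ≤ _ := by gcongr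

lemma pms_layer (δ m : ENNReal) (J : ℕ) (h : m ≤ 2 ^ J * δ) :
    m ≤ δ + ∑ j ∈ Finset.range J, (if 2 ^ j * δ < m then 2 ^ (j + 1) * δ else 0) := by
  induction J with
  | zero => simpa using h
  | succ J ih =>
    rw [Finset.sum_range_succ, ← add_assoc]
    by_cases hm : m ≤ 2 ^ J * δ
    · exact (ih hm).trans le_self_add
    · rw [if_pos (not_le.mp hm)]
      exact h.trans le_add_self

lemma pms_meas (X : Set ℂ) (hX : MeasurableSet X) (b : ℝ) :
    Measurable (fun x => volume (closedBall x b ∩ X)) := by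
  have hE : MeasurableSet {p : ℂ × ℂ | p.2 ∈ closedBall p.1 b ∩ X} := by
    apply MeasurableSet.inter
    · exact (isClosed_le (by fun_prop : Continuous fun p : ℂ × ℂ => dist p.2 p.1)
        continuous_const).measurableSet
    · exact measurable_snd hX
  exact measurable_measure_prodMk_left (ν := (volume : Measure ℂ)) hE

lemma pms_fubini (X S : Set ℂ) (hX : MeasurableSet X) (hS : MeasurableSet S) (b : ℝ) :
    ∫⁻ z in X, volume (closedBall z b ∩ S) = ∫⁻ x in S, volume (closedBall x b ∩ X) := by
  have hE : MeasurableSet {p : ℂ × ℂ | dist p.1 p.2 ≤ b} :=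
    (isClosed_le (by fun_prop : Continuous fun p : ℂ × ℂ => dist p.1 p.2)
        continuous_const).measurableSet
  have h1 := Measure.prod_apply (μ := volume.restrict X) (ν := volume.restrict S) hE
  have h2 := Measure.prod_apply_symm (μ := volume.restrict X) (ν := volume.restrict S) hE
  have e1 : ∀ z : ℂ, (volume.restrict S) (Prod.mk z ⁻¹' {p : ℂ × ℂ | dist p.1 p.2 ≤ b})
      = volume (closedBall z b ∩ S) := by
    intro z
    rw [Measure.restrict_apply' hS]
    congr 2
    ext x; simp [dist_comm]
  have e2 : ∀ x : ℂ, (volume.restrict X) ((fun z => (z, x)) ⁻¹' {p : ℂ × ℂ | dist p.1 p.2 ≤ b})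
      = volume (closedBall x b ∩ X) := by
    intro z
    rw [Measure.restrict_apply' hX]
    congr 2
  simp only [e1] at h1
  simp only [e2] at h2
  rw [← h1, h2]

/-- The integral of the (discrete) maximal function. -/
lemma pms_max (X D : Set ℂ) (hX : MeasurableSet X) (b : ℕ → ℝ) (hb : ∀ l, 0 < b l) (R0 : ℝ)
    (hR0 : ∀ l, b l ≤ R0) (δ : ENNReal) (hδ : δ ≠ 0) (hδ' : δ ≠ ⊤) (J : ℕ)
    (hJ : ENNReal.ofReal Real.pi ≤ 2 ^ J * δ) :
    ∫⁻ x in D, (⨆ l, volume (closedBall x (b l) ∩ X) / ENNReal.ofReal (b l ^ 2)) ≤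
      δ * volume D + J * (ENNReal.ofReal (32 * Real.pi) * volume X) := by
  set M : ℂ → ENNReal := fun x => ⨆ l, volume (closedBall x (b l) ∩ X) / ENNReal.ofReal (b l ^ 2)
    with hM
  have hMm : Measurable M := by
    apply Measurable.iSup
    intro l
    exact (pms_meas X hX (b l)).div_const _
  have hMle : ∀ x, M x ≤ ENNReal.ofReal Real.pi := by
    intro x
    apply iSup_le
    intro l
    apply ENNReal.div_le_of_le_mul
    rw [← ENNReal.ofReal_mul Real.pi_pos.le, ← pms_vol x (hb l).le]
    exact measure_mono Set.inter_subset_left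
  have hmeas : ∀ s : ENNReal, MeasurableSet {x | s < M x} := fun s => measurableSet_lt measurable_const hMm
  have hweak : ∀ s : ENNReal, s * volume {x | s < M x} ≤ ENNReal.ofReal (16 * Real.pi) * volume X := by
    intro s
    have : ∀ x, ∃ l, s < M x → s < volume (closedBall x (b l) ∩ X) / ENNReal.ofReal (b l ^ 2) := by
      intro x
      by_cases h : s < M x
      · obtain ⟨l, hl⟩ := lt_iSup_iff.mp h
        exact ⟨l, fun _ => hl⟩
      · exact ⟨0, fun h' => absurd h' h⟩
    choose L hL using this
    apply pms_weak X _ (fun x => b (L x)) R0 hX (fun x _ => ⟨hb _, hR0 _⟩)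
    intro x hx
    have h0 : 0 < b (L x) ^ 2 := by have := hb (L x); positivity
    have := (hL x hx).le
    rwa [ENNReal.le_div_iff_mul_le (Or.inl (ENNReal.ofReal_pos.mpr h0).ne') (Or.inl ENNReal.ofReal_ne_top)] at this
  calc ∫⁻ x in D, M x
      ≤ ∫⁻ x in D, (δ + ∑ j ∈ Finset.range J, (if 2 ^ j * δ < M x then 2 ^ (j + 1) * δ else 0)) :=
        lintegral_mono fun x => pms_layer δ (M x) J ((hMle x).trans hJ)
    _ = δ * volume D + ∑ j ∈ Finset.range J, ∫⁻ x in D, (if 2 ^ j * δ < M x then 2 ^ (j + 1) * δ else 0) := by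
        rw [lintegral_add_left measurable_const, lintegral_finsetSum]
        · simp
        · intro j _
          exact Measurable.ite (hmeas _) measurable_const measurable_const
    _ ≤ δ * volume D + ∑ j ∈ Finset.range J, (ENNReal.ofReal (32 * Real.pi) * volume X) := by
        gcongr with j _
        calc ∫⁻ x in D, (if 2 ^ j * δ < M x then 2 ^ (j + 1) * δ else 0)
            ≤ ∫⁻ x, (if 2 ^ j * δ < M x then 2 ^ (j + 1) * δ else 0) :=
              lintegral_mono' Measure.restrict_le_self le_rfl
          _ = ∫⁻ x, ({x | 2 ^ j * δ < M x}.indicator (fun _ => 2 ^ (j + 1) * δ) x) := by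
              simp [Set.indicator_apply]
          _ = 2 * ((2 ^ j * δ) * volume {x | 2 ^ j * δ < M x}) := by
              rw [lintegral_indicator (hmeas _)]
              simp
              ring
          _ ≤ 2 * (ENNReal.ofReal (16 * Real.pi) * volume X) := mul_le_mul_right (hweak _) 2
          _ = _ := by
              rw [← mul_assoc, show (2:ENNReal) = ENNReal.ofReal 2 by simp,
                ← ENNReal.ofReal_mul (by norm_num)]
              congr 2; ring
    _ = _ := by simp

lemma pms_core (X D : Set ℂ) (hX : MeasurableSet X) (hD : MeasurableSet D)
    (b : ℕ → ℝ) (hb : ∀ l, 0 < b l) (R0 : ℝ)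
    (hR0 : ∀ l, b l ≤ R0) (δ : ENNReal) (hδ : δ ≠ 0) (hδ' : δ ≠ ⊤) (J : ℕ)
    (hJ : ENNReal.ofReal Real.pi ≤ 2 ^ J * δ)
    (S : ℕ → Set ℂ) (hS : ∀ l, MeasurableSet (S l)) (hSD : ∀ l, S l ⊆ D) (N : ℕ)
    (hN : ∀ x l l', x ∈ S l → x ∈ S l' → l' < l + N) (n : ℕ) (c : ENNReal)
    (h : ∀ z ∈ X, ∃ l : Fin n → ℕ, StrictMono l ∧
      ∀ k, c * ENNReal.ofReal (b (l k) ^ 2) ≤ volume (closedBall z (b (l k)) ∩ S (l k))) :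
    n * c * volume X ≤ N * (δ * volume D + J * (ENNReal.ofReal (32 * Real.pi) * volume X)) := by
  have hb0 : ∀ l, 0 < b l ^ 2 := fun l => by have := hb l; positivity
  calc n * c * volume X = ∫⁻ z in X, n * c := by simp
    _ ≤ ∫⁻ z in X, ∑' l, volume (closedBall z (b l) ∩ S l) / ENNReal.ofReal (b l ^ 2) := by
        apply setLIntegral_mono' hX
        intro z hz
        obtain ⟨l, hl, hk⟩ := h z hz
        calc (n : ENNReal) * c = ∑ k : Fin n, c := by simp
          _ ≤ ∑ k : Fin n, volume (closedBall z (b (l k)) ∩ S (l k)) / ENNReal.ofReal (b (l k) ^ 2) := by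
              gcongr with k _
              rw [ENNReal.le_div_iff_mul_le (Or.inl (ENNReal.ofReal_pos.mpr (hb0 (l k))).ne') (Or.inl ENNReal.ofReal_ne_top)]
              exact hk k
          _ = ∑ j ∈ Finset.univ.map ⟨l, hl.injective⟩, volume (closedBall z (b j) ∩ S j) / ENNReal.ofReal (b j ^ 2) := by
              simp
          _ ≤ _ := ENNReal.sum_le_tsum _
    _ = ∑' l, ∫⁻ z in X, volume (closedBall z (b l) ∩ S l) / ENNReal.ofReal (b l ^ 2) := by
        apply lintegral_tsum
        intro l
        exact ((pms_meas _ (hS l) _).div_const _).aemeasurable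
    _ = ∑' l, ∫⁻ x in S l, volume (closedBall x (b l) ∩ X) / ENNReal.ofReal (b l ^ 2) := by
        congr 1; ext l
        simp only [div_eq_mul_inv]
        rw [lintegral_mul_const _ (pms_meas _ (hS l) _), lintegral_mul_const _ (pms_meas _ hX _),
          pms_fubini X (S l) hX (hS l)]
    _ ≤ ∑' l, ∫⁻ x in S l, (⨆ l, volume (closedBall x (b l) ∩ X) / ENNReal.ofReal (b l ^ 2)) := by
        apply ENNReal.tsum_le_tsum
        intro l
        apply lintegral_mono
        intro x
        exact le_iSup (fun l => volume (closedBall x (b l) ∩ X) / ENNReal.ofReal (b l ^ 2)) l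
    _ = ∑' l, ∫⁻ x in D, (S l).indicator (fun x => ⨆ l, volume (closedBall x (b l) ∩ X) / ENNReal.ofReal (b l ^ 2)) x := by
        congr 1; ext l
        rw [setLIntegral_indicator (hS l), Set.inter_eq_left.mpr (hSD l)]
    _ = ∫⁻ x in D, ∑' l, (S l).indicator (fun x => ⨆ l, volume (closedBall x (b l) ∩ X) / ENNReal.ofReal (b l ^ 2)) x := by
        symm
        apply lintegral_tsum
        intro l
        apply Measurable.aemeasurable
        apply Measurable.indicator _ (hS l)
        apply Measurable.iSup
        intro l
        exact (pms_meas X hX (b l)).div_const _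
    _ ≤ ∫⁻ x in D, N * (⨆ l, volume (closedBall x (b l) ∩ X) / ENNReal.ofReal (b l ^ 2)) := by
        apply lintegral_mono
        intro x
        by_cases hx : ∃ l, x ∈ S l
        · classical
          have h0 := Nat.find_spec hx
          have hmin := fun m => Nat.find_min' hx (m := m)
          set l0 := Nat.find hx
          dsimp only
          rw [tsum_eq_sum (s := Finset.Ico l0 (l0 + N))]
          · calc _ ≤ ∑ l ∈ Finset.Ico l0 (l0 + N), (⨆ l, volume (closedBall x (b l) ∩ X) / ENNReal.ofReal (b l ^ 2)) := by
                  gcongr with l _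
                  exact Set.indicator_le_self _ _ _
              _ = _ := by simp
          · intro l hl
            apply Set.indicator_of_notMem
            intro hxl
            exact hl (Finset.mem_Ico.mpr ⟨hmin l hxl, hN x l0 l h0 hxl⟩)
        · push Not at hx
          simp [hx]
    _ = N * ∫⁻ x in D, (⨆ l, volume (closedBall x (b l) ∩ X) / ENNReal.ofReal (b l ^ 2)) := by
        apply lintegral_const_mul
        apply Measurable.iSup
        intro l
        exact (pms_meas X hX (b l)).div_const _
    _ ≤ _ := by
        gcongr
        exact pms_max X D hX b hb R0 hR0 δ hδ hδ' J hJ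

lemma pms_geom (ρ C ε r : ℝ) (hρ : 0 < ρ) (hρ1 : ρ < 1) (hC : 1 ≤ C) (hε : 0 < ε) (hε1 : ε < 1)
    (N : ℕ) (hN : ρ ^ N < ε / (2 * C ^ 2)) (hr : 0 < r) (n J : ℕ) (X : Set ℂ)
    (hX : MeasurableSet X) (hXr : X ⊆ ball (0 : ℂ) r)
    (h : ∀ z ∈ X, ∃ l : Fin n → ℕ, StrictMono l ∧ ∃ rad : Fin n → ℝ,
          (∀ k, C⁻¹ * ρ ^ (l k) ≤ rad k / r ∧ rad k / r ≤ C * ρ ^ (l k)) ∧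
          (∀ k, ∃ w : ℂ, ball w (ε * rad k) ⊆ ball z (rad k) ∧
            Disjoint (ball w (ε * rad k)) X))
    (hJ : Real.pi * r ^ 2 ≤ 2 ^ J * (volume X).toReal) :
    n * (Real.pi * ε ^ 2 / (4 * C ^ 4)) ≤ N * (4 * Real.pi * C ^ 2 + J * (32 * Real.pi)) := by
  have hC0 : 0 < C := by linarith
  have hpi := Real.pi_pos
  set V := (volume X).toReal with hV
  have hfin : volume X ≠ ⊤ := ((measure_mono hXr).trans_lt measure_ball_lt_top).ne
  have hVX : volume X = ENNReal.ofReal V := (ENNReal.ofReal_toReal hfin).symm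
  have hV0 : 0 < V := by
    have : 0 < 2 ^ J * V := lt_of_lt_of_le (by positivity) hJ
    exact pos_of_mul_pos_right this (by positivity)
  have hcore := pms_core X (ball 0 (2 * C * r)) hX measurableSet_ball
    (fun l => C * (ρ ^ l * r)) (fun l => by positivity) (C * r)
    (fun l => by
      have : ρ ^ l ≤ 1 := pow_le_one₀ hρ.le hρ1.le
      have : ρ ^ l * r ≤ 1 * r := by gcongr
      rw [one_mul] at this
      gcongr)
    (ENNReal.ofReal (V / r ^ 2)) (by simp; positivity) ENNReal.ofReal_ne_top J
    (by
      rw [show (2 : ENNReal) = ENNReal.ofReal 2 by simp, ← ENNReal.ofReal_pow (by norm_num),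
        ← ENNReal.ofReal_mul (by positivity)]
      apply ENNReal.ofReal_le_ofReal
      rw [← mul_div_assoc, le_div_iff₀ (by positivity)]
      exact hJ)
    (fun l => ball 0 (2 * C * r) ∩ {x | ε / (2 * C) * (ρ ^ l * r) ≤ infDist x X ∧ infDist x X ≤ C * (ρ ^ l * r)})
    (fun l => measurableSet_ball.inter
      ((isClosed_le continuous_const (continuous_infDist_pt X)).measurableSet.inter
        (isClosed_le (continuous_infDist_pt X) continuous_const).measurableSet))
    (fun l => Set.inter_subset_left) N
    (by
      rintro x l l' ⟨-, h1, -⟩ ⟨-, -, h2⟩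
      by_contra hcon
      push Not at hcon
      have h3 : ρ ^ l' ≤ ρ ^ (l + N) := pow_le_pow_of_le_one hρ.le hρ1.le hcon
      have h4 : C * (ρ ^ l' * r) ≤ C * (ρ ^ (l + N) * r) := by gcongr
      have h5 : C * (ρ ^ (l + N) * r) < ε / (2 * C) * (ρ ^ l * r) := by
        calc C * (ρ ^ (l + N) * r) = (C * (ρ ^ l * r)) * ρ ^ N := by ring
          _ < (C * (ρ ^ l * r)) * (ε / (2 * C ^ 2)) := by gcongr
          _ = _ := by field_simp
      linarith)
    n (ENNReal.ofReal (Real.pi * ε ^ 2 / (4 * C ^ 4)))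
    (by
      intro z hz
      obtain ⟨l, hl, rad, hrad, hw⟩ := h z hz
      refine ⟨l, hl, fun k => ?_⟩
      obtain ⟨w, hw1, hw2⟩ := hw k
      obtain ⟨g1, g2⟩ := hrad k
      set s := rad k
      set q := ρ ^ l k with hq
      have hq0 : 0 < q := by positivity
      have hq1 : q ≤ 1 := pow_le_one₀ hρ.le hρ1.le
      rw [le_div_iff₀ hr] at g1
      rw [div_le_iff₀ hr] at g2
      have hs : 0 < s := lt_of_lt_of_le (by positivity) g1
      have hsub : ball w (ε * s / 2) ⊆ closedBall z (C * (q * r)) ∩ (ball 0 (2 * C * r) ∩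
          {x | ε / (2 * C) * (q * r) ≤ infDist x X ∧ infDist x X ≤ C * (q * r)}) := by
        intro x hx
        have hxw : x ∈ ball w (ε * s) := ball_subset_ball (by nlinarith [mul_pos hε hs]) hx
        have hxz : dist x z < s := hw1 hxw
        have hz0 : dist z 0 < r := hXr hz
        have hsC : s ≤ C * r := by
          have : C * q * r ≤ C * 1 * r := by gcongr
          linarith
        refine ⟨?_, ?_, ?_, ?_⟩
        · rw [mem_closedBall]; linarith
        · rw [mem_ball]
          have := dist_triangle x z 0
          nlinarith
        · apply le_trans (b := ε * s / 2)
          · have : ε / 2 * (C⁻¹ * q * r) ≤ ε / 2 * s := by gcongr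
            calc _ = ε / 2 * (C⁻¹ * q * r) := by field_simp
              _ ≤ _ := this
              _ = _ := by ring
          · rw [le_infDist ⟨z, hz⟩]
            intro y hy
            by_contra hcon
            push Not at hcon
            apply Set.disjoint_left.mp hw2 _ hy
            rw [mem_ball] at hx ⊢
            have := dist_triangle y x w
            rw [dist_comm y x] at this
            linarith
        · have := infDist_le_dist_of_mem (x := x) hz
          linarith
      refine le_trans ?_ (measure_mono hsub)
      rw [pms_vol' _ (by positivity), ← ENNReal.ofReal_mul (by positivity)]
      apply ENNReal.ofReal_le_ofReal
      calc Real.pi * ε ^ 2 / (4 * C ^ 4) * (C * (q * r)) ^ 2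
          = Real.pi * (ε * (C⁻¹ * q * r) / 2) ^ 2 := by field_simp; ring
        _ ≤ _ := by gcongr)
  rw [pms_vol' _ (by positivity), hVX] at hcore
  rw [← ENNReal.ofReal_natCast n, ← ENNReal.ofReal_natCast N, ← ENNReal.ofReal_natCast J,
    ← ENNReal.ofReal_mul (by positivity), ← ENNReal.ofReal_mul (by positivity),
    ← ENNReal.ofReal_mul (by positivity), ← ENNReal.ofReal_mul (by positivity),
    ← ENNReal.ofReal_mul (by positivity), ← ENNReal.ofReal_add (by positivity) (by positivity),
    ← ENNReal.ofReal_mul (by positivity), ENNReal.ofReal_le_ofReal_iff (by positivity)] at hcore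
  have e : (N : ℝ) * (V / r ^ 2 * (Real.pi * (2 * C * r) ^ 2) + J * (32 * Real.pi * V))
      = (N * (4 * Real.pi * C ^ 2 + J * (32 * Real.pi))) * V := by
    field_simp; ring
  rw [e] at hcore
  exact le_of_mul_le_mul_right hcore hV0

/-- Porosity in many scales: if every point of a measurable set `X ⊆ D_r` sees gaps of
definite relative size `ε` in `n` disks whose radii lie (up to a constant `C`) in `n`
distinct geometric scales `ρ^{l_1} > ρ^{l_2} > …`, then the area of `X` is exponentially
small in `n`. -/
theorem porosity_many_scales :
    ∀ ρ : ℝ, ρ ∈ Set.Ioo (0 : ℝ) 1 → ∀ C : ℝ, 1 ≤ C → ∀ ε : ℝ, ε ∈ Set.Ioo (0 : ℝ) 1 →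
    ∃ σ ∈ Set.Ioo (0 : ℝ) 1, ∃ C₁ > (0 : ℝ),
      ∀ r > (0 : ℝ), ∀ n : ℕ, ∀ X : Set ℂ, MeasurableSet X → X ⊆ ball (0 : ℂ) r →
        (∀ z ∈ X, ∃ l : Fin n → ℕ, StrictMono l ∧ ∃ rad : Fin n → ℝ,
          (∀ k, C⁻¹ * ρ ^ (l k) ≤ rad k / r ∧ rad k / r ≤ C * ρ ^ (l k)) ∧
          (∀ k, ∃ w : ℂ, ball w (ε * rad k) ⊆ ball z (rad k) ∧
            Disjoint (ball w (ε * rad k)) X)) →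
        volume X ≤ ENNReal.ofReal (C₁ * σ ^ n * r ^ 2) := by
  rintro ρ ⟨hρ, hρ1⟩ C hC ε ⟨hε, hε1⟩
  have hC0 : 0 < C := by linarith
  have hpi := Real.pi_pos
  obtain ⟨N, hN⟩ := exists_pow_lt_of_lt_one (show 0 < ε / (2 * C ^ 2) by positivity) hρ1
  set c := Real.pi * ε ^ 2 / (4 * C ^ 4) with hc
  have hc0 : 0 < c := by positivity
  obtain ⟨A0, hA0⟩ := exists_nat_ge (N * (32 * Real.pi * C ^ 2) / c)
  set A : ℕ := A0 + 1 with hA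
  have hA1 : 0 < A := by omega
  have hAr : (1 : ℝ) ≤ A := by exact_mod_cast hA1
  have hAc : N * (32 * Real.pi * C ^ 2) ≤ A * c := by
    rw [div_le_iff₀ hc0] at hA0
    rw [hA]; push_cast; nlinarith
  set σ : ℝ := 1 - 1 / (2 * A) with hσ
  have hdiv : 1 / (2 * (A : ℝ)) ≤ 1 / 2 := by
    apply one_div_le_one_div_of_le <;> linarith
  have hdiv0 : 0 < 1 / (2 * (A : ℝ)) := by positivity
  have hσ0 : 0 < σ := by linarith
  have hσ1 : σ < 1 := by linarith
  have hσA : 1 / 2 ≤ σ ^ A := by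
    have := one_add_mul_le_pow (a := -(1 / (2 * (A : ℝ)))) (by linarith) A
    rw [← sub_eq_add_neg, ← hσ] at this
    refine le_trans (le_of_eq ?_) this
    field_simp; norm_num
  refine ⟨σ, ⟨hσ0, hσ1⟩, 8 * Real.pi, by positivity, ?_⟩
  intro r hr n X hX hXr h
  have hXle : volume X ≤ ENNReal.ofReal (Real.pi * r ^ 2) := by
    rw [← pms_vol' 0 hr.le]; exact measure_mono hXr
  have hfin : volume X ≠ ⊤ := (hXle.trans_lt ENNReal.ofReal_lt_top).ne
  have hσn : (1 / 2 : ℝ) ^ (n / A + 1) ≤ σ ^ n := by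
    calc (1 / 2 : ℝ) ^ (n / A + 1) ≤ (σ ^ A) ^ (n / A + 1) := by gcongr
      _ = σ ^ (A * (n / A + 1)) := (pow_mul _ _ _).symm
      _ ≤ σ ^ n := pow_le_pow_of_le_one hσ0.le hσ1.le (Nat.lt_mul_div_succ n hA1).le
  rw [ENNReal.le_ofReal_iff_toReal_le hfin (by positivity)]
  have hXle' : (volume X).toReal ≤ Real.pi * r ^ 2 := by
    rwa [ENNReal.le_ofReal_iff_toReal_le hfin (by positivity)] at hXle
  by_cases hq : n / A < 2
  · have : (1 / 2 : ℝ) ^ 2 ≤ σ ^ n :=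
      le_trans (pow_le_pow_of_le_one (by norm_num) (by norm_num) (by omega)) hσn
    have h3 : 1 * (Real.pi * r ^ 2) ≤ 8 * σ ^ n * (Real.pi * r ^ 2) := by
      gcongr; linarith
    linarith
  · obtain ⟨J, hJ⟩ : ∃ J, n / A = J + 2 := ⟨n / A - 2, by omega⟩
    rw [hJ] at hσn
    by_cases hcase : Real.pi * r ^ 2 ≤ 2 ^ J * (volume X).toReal
    · exfalso
      have key := pms_geom ρ C ε r hρ hρ1 hC hε hε1 N hN hr n J X hX hXr h hcase
      rw [← hc] at key
      have hn : A * (J + 2) ≤ n := hJ ▸ Nat.mul_div_le n A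
      have hn' : (A : ℝ) * (J + 2) ≤ n := by exact_mod_cast hn
      have h1 : 4 * Real.pi * C ^ 2 + J * (32 * Real.pi) ≤ 32 * Real.pi * C ^ 2 * (J + 1) := by
        have hC2 : 1 ≤ C ^ 2 := one_le_pow₀ hC
        have : J * (32 * Real.pi) * 1 ≤ J * (32 * Real.pi) * C ^ 2 := by gcongr
        have : 0 < Real.pi * C ^ 2 := by positivity
        nlinarith
      have h2 : (n : ℝ) * c ≤ A * c * (J + 1) := by
        calc (n : ℝ) * c ≤ _ := key
          _ ≤ N * (32 * Real.pi * C ^ 2 * (J + 1)) := by gcongr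
          _ = N * (32 * Real.pi * C ^ 2) * (J + 1) := by ring
          _ ≤ _ := by gcongr
      have h3 : (A : ℝ) * (J + 2) * c ≤ n * c := by gcongr
      have : 0 < (A : ℝ) * c := by positivity
      nlinarith
    · push Not at hcase
      have h1 : (volume X).toReal ≤ (1 / 2) ^ J * (Real.pi * r ^ 2) := by
        rw [one_div, inv_pow, ← div_eq_inv_mul, le_div_iff₀ (by positivity)]
        linarith
      have h2 : (8 * (1 / 2 : ℝ) ^ (J + 2 + 1)) * (Real.pi * r ^ 2) ≤ (8 * σ ^ n) * (Real.pi * r ^ 2) := by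
        gcongr
      have e : (8 * (1 / 2 : ℝ) ^ (J + 2 + 1)) = (1 / 2) ^ J := by ring
      rw [e] at h2
      linarith
end

section
/- (Cross-ratio contraction for conformal self-maps of the slit plane; the contraction property equivalent to non-positive Schwarzian which is directly used in the distortion bounds.) Let G : ℂ → ℂ be holomorphic and injective on the slit plane Ω = ℂ ∖ (−∞,0], with G(Ω) ⊆ Ω, with G mapping (0,∞) into (0,∞) (in particular G is real-valued there), and with G strictly increasing on (0,∞). Then G does not increase the hyperbolic cross-ratio of nested real intervals: for all real numbers 0 < a < b < c < d one has ((G(c)−G(a))·(G(d)−G(b))) / ((G(b)−G(a))·(G(d)−G(c))) ≤ ((c−a)·(d−b)) / ((b−a)·(d−c)). -/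
open Complex

/-- Schwarz-Pick on the right half-plane, real points. -/
lemma rhp_schwarz (h : ℂ → ℂ) (hd : ∀ w : ℂ, 0 < w.re → DifferentiableAt ℂ h w)
    (hm : ∀ w : ℂ, 0 < w.re → 0 < (h w).re) (u v P Q : ℝ) (hu : 0 < u) (huv : u < v)
    (hP : h u = P) (hQ : h v = Q) : Q * u ≤ v * P := by
  have hv : 0 < v := hu.trans huv
  have hPpos : 0 < P := by simpa [hP] using hm u (by simpa using hu)
  have hQpos : 0 < Q := by simpa [hQ] using hm v (by simpa using hv)
  have h1 : ∀ z : ℂ, z ∈ Metric.ball (0 : ℂ) 1 → 1 - z ≠ 0 := by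
    intro z hz h0
    have : z = 1 := (sub_eq_zero.1 h0).symm
    simp [this] at hz
  have hre : ∀ z : ℂ, z ∈ Metric.ball (0 : ℂ) 1 → 0 < ((u : ℂ) * ((1 + z) / (1 - z))).re := by
    intro z hz
    have hn : 0 < normSq (1 - z) := normSq_pos.2 (h1 z hz)
    have hz1 : normSq z < 1 := by
      have : ‖z‖ < 1 := by simpa using hz
      rw [normSq_eq_norm_sq]; nlinarith [norm_nonneg z]
    rw [re_ofReal_mul]
    apply mul_pos hu
    rw [div_re, ← add_div]
    apply div_pos _ hn
    rw [normSq_apply] at hz1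
    simp
    nlinarith
  have hne : ∀ w : ℂ, 0 < w.re → w + P ≠ 0 := by
    intro w hw h0
    have := congrArg re h0
    simp at this
    linarith
  set g : ℂ → ℂ := fun z => (h (u * ((1 + z) / (1 - z))) - P) / (h (u * ((1 + z) / (1 - z))) + P)
    with hg
  have hgd : DifferentiableOn ℂ g (Metric.ball 0 1) := by
    intro z hz
    apply DifferentiableAt.differentiableWithinAt
    have hi : DifferentiableAt ℂ (fun z : ℂ => (u : ℂ) * ((1 + z) / (1 - z))) z := by
      have := h1 z hz
      fun_prop (disch := assumption)
    have hc : DifferentiableAt ℂ (fun z : ℂ => h ((u : ℂ) * ((1 + z) / (1 - z)))) z :=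
      (hd _ (hre z hz)).comp z hi
    exact (hc.sub_const _).div (hc.add_const _) (hne _ (hm _ (hre z hz)))
  have hgm : Set.MapsTo g (Metric.ball 0 1) (Metric.closedBall 0 1) := by
    intro z hz
    have hw := hm _ (hre z hz)
    simp only [hg, mem_closedBall_zero_iff, norm_div]
    apply div_le_one_of_le₀ _ (norm_nonneg _)
    rw [Complex.norm_def, Complex.norm_def]
    apply Real.sqrt_le_sqrt
    simp only [normSq_apply, sub_re, sub_im, add_re, add_im, ofReal_re, ofReal_im]
    nlinarith [mul_pos hw hPpos]
  have hg0 : g 0 = 0 := by simp [hg, hP]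
  set t : ℝ := (v - u) / (v + u) with ht
  have ht0 : 0 < t := div_pos (by linarith) (by linarith)
  have ht1 : t < 1 := by rw [ht, div_lt_one (by linarith)]; linarith
  have key := Complex.norm_le_norm_of_mapsTo_ball (z := (t : ℂ)) hgd hgm hg0
    (by rw [norm_real, Real.norm_of_nonneg ht0.le]; exact ht1)
  have hut : (u : ℂ) * ((1 + t) / (1 - t)) = (v : ℂ) := by
    have : u * ((1 + t) / (1 - t)) = v := by
      have h2 : 1 - t ≠ 0 := by linarith
      have h3 : v + u ≠ 0 := by linarith
      rw [mul_div_assoc', div_eq_iff h2, ht]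
      field_simp
      ring
    exact_mod_cast this
  have hgt : g t = ((Q - P) / (Q + P) : ℝ) := by
    simp only [hg, hut, hQ]; push_cast; rfl
  rw [hgt, norm_real, norm_real, Real.norm_of_nonneg ht0.le] at key
  have := (le_abs_self _).trans key
  rw [ht, div_le_div_iff₀ (by linarith) (by linarith)] at this
  nlinarith

lemma slit_schwarz (F : ℂ → ℂ) (hd : ∀ w ∈ slitPlane, DifferentiableAt ℂ F w)
    (hm : ∀ w ∈ slitPlane, F w ∈ slitPlane) (u v P Q : ℝ) (hu : 0 < u) (huv : u < v)
    (hP : F u = P) (hQ : F v = Q) (hP0 : 0 < P) (hQ0 : 0 < Q) : Q * u ≤ v * P := by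
  have hv : 0 < v := hu.trans huv
  have hsq : ∀ w : ℂ, 0 < w.re → w ^ 2 ∈ slitPlane := by
    intro w hw
    rw [mem_slitPlane_iff]
    by_cases hi : w.im = 0
    · left; simp [sq, hi]; positivity
    · right; simp [sq]
      intro h
      have h2 : w.re * w.im = 0 := by linarith
      rcases mul_eq_zero.1 h2 with h3 | h3
      · linarith
      · exact hi h3
  have hval : ∀ x R : ℝ, 0 < x → 0 < R → F x = R →
      exp (log (F ((√x : ℝ) ^ 2 : ℂ)) / 2) = (√R : ℝ) := by
    intro x R hx hR hF
    rw [← ofReal_pow, Real.sq_sqrt hx.le, hF, ← ofReal_log hR.le]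
    rw [Real.sqrt_eq_rpow, Real.rpow_def_of_pos hR]
    push_cast
    congr 1; ring
  have key := rhp_schwarz (fun w => exp (log (F (w ^ 2)) / 2)) ?_ ?_ (√u) (√v) (√P) (√Q)
    (Real.sqrt_pos.2 hu) (Real.sqrt_lt_sqrt hu.le huv) (hval u P hu hP0 hP) (hval v Q hv hQ0 hQ)
  · rw [← Real.sqrt_mul hQ0.le, ← Real.sqrt_mul hv.le] at key
    exact (Real.sqrt_le_sqrt_iff (by positivity)).1 key
  · intro w hw
    have h1 : DifferentiableAt ℂ (fun w => F (w ^ 2)) w :=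
      DifferentiableAt.comp w (hd _ (hsq w hw)) (by fun_prop)
    exact ((h1.clog (hm _ (hsq w hw))).div_const 2).cexp
  · intro w hw
    have h1 := hm _ (hsq w hw)
    have hlt := arg_lt_pi_iff.2 (by
      rcases mem_slitPlane_iff.1 h1 with h | h
      · exact Or.inl h.le
      · exact Or.inr h)
    have hgt := neg_pi_lt_arg (F (w ^ 2))
    have him : (log (F (w ^ 2)) / 2).im = arg (F (w ^ 2)) / 2 := by
      rw [← log_im]; simp
    simp only [exp_re, him]
    exact mul_pos (Real.exp_pos _) (Real.cos_pos_of_mem_Ioo ⟨by linarith, by linarith⟩)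

lemma slit_reflect (G : ℂ → ℂ) (hG : ∀ z ∈ slitPlane, DifferentiableAt ℂ G z)
    (hreal : ∀ x : ℝ, 0 < x → (G x).im = 0) :
    ∀ z ∈ slitPlane, (starRingEnd ℂ) (G ((starRingEnd ℂ) z)) = G z := by
  have hc : ∀ z ∈ slitPlane, (starRingEnd ℂ) z ∈ slitPlane := by
    intro z hz
    simpa [mem_slitPlane_iff] using hz
  have hf : AnalyticOnNhd ℂ G slitPlane :=
    DifferentiableOn.analyticOnNhd (fun z hz => (hG z hz).differentiableWithinAt) isOpen_slitPlane
  have hg : AnalyticOnNhd ℂ ((starRingEnd ℂ) ∘ G ∘ (starRingEnd ℂ)) slitPlane :=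
    DifferentiableOn.analyticOnNhd (fun z hz =>
      (differentiableAt_conj_conj_iff.2 (hG _ (hc z hz))).differentiableWithinAt) isOpen_slitPlane
  have hpre : IsPreconnected slitPlane :=
    (starConvex_one_slitPlane.isPathConnected (by simp)).isConnected.isPreconnected
  have := hg.eqOn_of_preconnected_of_frequently_eq hf hpre (z₀ := 1) (by simp) ?_
  · exact this
  · have ht : Filter.Tendsto (fun x : ℝ => (x : ℂ)) (nhdsWithin 1 {1}ᶜ)
        (nhdsWithin 1 {1}ᶜ) := by
      apply tendsto_nhdsWithin_of_tendsto_nhds_of_eventually_within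
      · have := (continuous_ofReal.tendsto (1 : ℝ))
        simp only [ofReal_one] at this
        exact this.mono_left nhdsWithin_le_nhds
      · filter_upwards [self_mem_nhdsWithin] with x hx
        simpa using hx
    apply ht.frequently
    apply Filter.Eventually.frequently
    filter_upwards [nhdsWithin_le_nhds (lt_mem_nhds (zero_lt_one' ℝ))] with x hx
    simp only [Function.comp_apply, conj_ofReal]
    exact conj_eq_iff_im.2 (hreal x hx)

/-- Cross-ratio contraction for conformal self-maps of the slit plane: a holomorphic
injective self-map of `ℂ ∖ (−∞,0]` preserving the positive real axis and increasing
there does not increase the hyperbolic cross-ratio of nested real intervals. -/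
theorem crossRatio_contraction_slitPlane
    (G : ℂ → ℂ)
    (hG : ∀ z ∈ Complex.slitPlane, DifferentiableAt ℂ G z)
    (hinj : Set.InjOn G Complex.slitPlane)
    (hmaps : Set.MapsTo G Complex.slitPlane Complex.slitPlane)
    (hreal : ∀ x : ℝ, 0 < x → (G x).im = 0 ∧ 0 < (G x).re)
    (hmono : ∀ x y : ℝ, 0 < x → x < y → (G x).re < (G y).re) :
    ∀ a b c d : ℝ, 0 < a → a < b → b < c → c < d →
      ((G c).re - (G a).re) * ((G d).re - (G b).re) /
          (((G b).re - (G a).re) * ((G d).re - (G c).re)) ≤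
        (c - a) * (d - b) / ((b - a) * (d - c)) := by
  intro a b c d ha hab hbc hcd
  have hrefl := slit_reflect G hG (fun x hx => (hreal x hx).1)
  have hGr : ∀ x : ℝ, 0 < x → G x = ((G x).re : ℂ) := by
    intro x hx
    apply Complex.ext <;> simp [(hreal x hx).1]
  have hGim : ∀ z ∈ slitPlane, z.im ≠ 0 → (G z).im ≠ 0 := by
    intro z hz hi h0
    have hcz : (starRingEnd ℂ) z ∈ slitPlane := by simp [mem_slitPlane_iff, hi]
    have h1 := hrefl z hz
    have h2 : G ((starRingEnd ℂ) z) = G z := by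
      have := congrArg (starRingEnd ℂ) h1
      rw [conj_conj, conj_eq_iff_im.2 h0] at this
      exact this
    exact hi (conj_eq_iff_im.1 (hinj hcz hz h2))
  set A := (G a).re with hA
  set D := (G d).re with hD
  have hAb := hmono a b ha hab
  have hbc' := hmono b c (by linarith) hbc
  have hcD := hmono c d (by linarith) hcd
  -- the inverse Moebius map
  have hs1 : ∀ s ∈ slitPlane, 1 + s ≠ 0 := by
    intro s hs h0
    have : s = -1 := by linear_combination h0
    simp [this, mem_slitPlane_iff] at hs
    linarith
  have him : ∀ s ∈ slitPlane, s.im ≠ 0 → ((a + d * s) / (1 + s)).im ≠ 0 := by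
    intro s hs hi h0
    have hn : normSq (1 + s) ≠ 0 := normSq_eq_zero.not.2 (hs1 s hs)
    rw [div_im, ← sub_div, div_eq_zero_iff] at h0
    rcases h0 with h0 | h0
    · simp at h0
      have : s.im * (d - a) = 0 := by linarith
      rcases mul_eq_zero.1 this with h | h
      · exact hi h
      · linarith
    · exact hn h0
  have hrl : ∀ s ∈ slitPlane, s.im = 0 → ∃ x : ℝ, a < x ∧ x < d ∧
      ((a + d * s) / (1 + s)) = (x : ℂ) := by
    intro s hs hi
    have hsr : 0 < s.re := by
      rcases mem_slitPlane_iff.1 hs with h | h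
      · exact h
      · exact absurd hi h
    have hse : s = (s.re : ℂ) := by apply Complex.ext <;> simp [hi]
    refine ⟨(a + d * s.re) / (1 + s.re), ?_, ?_, ?_⟩
    · rw [lt_div_iff₀ (by linarith)]; nlinarith
    · rw [div_lt_iff₀ (by linarith)]; nlinarith
    · rw [hse]; push_cast; simp
  have hzs : ∀ s ∈ slitPlane, ((a + d * s) / (1 + s)) ∈ slitPlane := by
    intro s hs
    by_cases hi : s.im = 0
    · obtain ⟨x, hx, _, he⟩ := hrl s hs hi
      rw [he]; exact ofReal_mem_slitPlane.2 (by linarith)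
    · exact mem_slitPlane_iff.2 (Or.inr (him s hs hi))
  have hden : ∀ s ∈ slitPlane, (D : ℂ) - G ((a + d * s) / (1 + s)) ≠ 0 := by
    intro s hs h0
    by_cases hi : s.im = 0
    · obtain ⟨x, hx, hxd, he⟩ := hrl s hs hi
      rw [he] at h0
      have := congrArg re h0
      simp at this
      have := hmono x d (by linarith) hxd
      linarith
    · have h1 := hGim _ (hzs s hs) (him s hs hi)
      have := congrArg im h0
      simp only [sub_im, ofReal_im, zero_im, zero_sub, neg_eq_zero] at this
      exact h1 this
  set F : ℂ → ℂ := fun s => (G ((a + d * s) / (1 + s)) - A) / (D - G ((a + d * s) / (1 + s)))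
    with hF
  have hFd : ∀ s ∈ slitPlane, DifferentiableAt ℂ F s := by
    intro s hs
    have hi : DifferentiableAt ℂ (fun s : ℂ => ((a : ℂ) + d * s) / (1 + s)) s := by
      have := hs1 s hs
      fun_prop (disch := assumption)
    have hc : DifferentiableAt ℂ (fun s : ℂ => G (((a : ℂ) + d * s) / (1 + s))) s :=
      (hG _ (hzs s hs)).comp s hi
    exact (hc.sub_const _).div (hc.const_sub _) (hden s hs)
  have hFm : ∀ s ∈ slitPlane, F s ∈ slitPlane := by
    intro s hs
    by_cases hi : s.im = 0
    · obtain ⟨x, hx, hxd, he⟩ := hrl s hs hi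
      have hx0 : 0 < x := by linarith
      simp only [hF, he]
      rw [hGr x hx0, ← ofReal_sub, ← ofReal_sub, ← ofReal_div, ofReal_mem_slitPlane]
      exact div_pos (sub_pos.2 (hmono a x ha hx)) (sub_pos.2 (hmono x d hx0 hxd))
    · have h1 := hGim _ (hzs s hs) (him s hs hi)
      have hn : normSq ((D : ℂ) - G ((a + d * s) / (1 + s))) ≠ 0 :=
        normSq_eq_zero.not.2 (hden s hs)
      apply mem_slitPlane_iff.2 (Or.inr _)
      simp only [hF]
      generalize G ((a + d * s) / (1 + s)) = w at *
      intro h0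
      rw [div_im, ← sub_div, div_eq_zero_iff] at h0
      rcases h0 with h0 | h0
      · simp at h0
        have : w.im * (D - A) = 0 := by linarith
        rcases mul_eq_zero.1 this with h | h
        · exact h1 h
        · linarith
      · exact hn h0
  have hFv : ∀ x : ℝ, a < x → x < d →
      F (((x - a) / (d - x) : ℝ)) = ((((G x).re - A) / (D - (G x).re) : ℝ) : ℂ) := by
    intro x hx hxd
    have e : ((a : ℂ) + d * (((x - a) / (d - x) : ℝ) : ℂ)) / (1 + (((x - a) / (d - x) : ℝ) : ℂ))
        = (x : ℂ) := by
      have : (a + d * ((x - a) / (d - x))) / (1 + (x - a) / (d - x)) = x := by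
        have h1 : d - x ≠ 0 := by linarith
        have h2 : 0 < (x - a) / (d - x) := div_pos (by linarith) (by linarith)
        rw [div_eq_iff (by linarith)]
        field_simp
        ring
      exact_mod_cast this
    simp only [hF, e]
    rw [hGr x (by linarith)]
    push_cast
    simp
  have key := slit_schwarz F hFd hFm ((b - a) / (d - b)) ((c - a) / (d - c)) _ _
    (div_pos (by linarith) (by linarith))
    (by rw [div_lt_div_iff₀ (by linarith) (by linarith)]; nlinarith)
    (hFv b hab (by linarith)) (hFv c (by linarith) hcd)
    (div_pos (by linarith) (by linarith)) (div_pos (by linarith) (by linarith))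
  have p1 : 0 < (G b).re - A := by linarith
  have p2 : 0 < D - (G c).re := by linarith
  have p3 : 0 < D - (G b).re := by linarith
  have q1 : 0 < b - a := by linarith
  have q2 : 0 < d - c := by linarith
  have q3 : 0 < d - b := by linarith
  rw [div_mul_div_comm, div_mul_div_comm, div_le_div_iff₀ (by positivity) (by positivity)] at key
  rw [div_le_div_iff₀ (by positivity) (by positivity)]
  linarith
end

section
/- (Epstein-type inverse branch implies non-positive Schwarzian, the content of the lemma that maps of the normalized Epstein class have non-positive Schwarzian derivative on the punctured line; the branch on the negative axis is symmetric.) Let F : ℝ → ℝ be three times continuously differentiable on (0,∞) with F′(x) > 0 and F(x) > 0 for all x > 0. Suppose the inverse branch of F admits a conformal extension to the slit plane into itself: there exists G : ℂ → ℂ, holomorphic and injective on Ω = ℂ ∖ (−∞,0], with G(Ω) ⊆ Ω and G(F(x)) = x for every x > 0. Then the Schwarzian derivative of F is non-positive on (0,∞): SF(x) = F‴(x)/F′(x) − (3/2)·(F″(x)/F′(x))² ≤ 0 for every x > 0. -/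
open Complex

lemma normSq_conj_id (z w : ℂ) : ‖z - (starRingEnd ℂ) w‖^2 = ‖z-w‖^2 + 4 * z.im * w.im := by
  rw [← Complex.normSq_eq_norm_sq, ← Complex.normSq_eq_norm_sq]
  simp [Complex.normSq_apply]; ring

lemma sub_conj_ne {z w : ℂ} (hz : 0 < z.im) (hw : 0 < w.im) : z - (starRingEnd ℂ) w ≠ 0 := by
  intro h
  have := congrArg Complex.im h
  simp at this; linarith

lemma pick (f : ℂ → ℂ) (hf : ∀ z : ℂ, 0 < z.im → DifferentiableAt ℂ f z)
    (hm : ∀ z : ℂ, 0 < z.im → 0 < (f z).im) (z w : ℂ) (hz : 0 < z.im) (hw : 0 < w.im) :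
    ‖f z - f w‖^2 * (z.im * w.im) ≤ ‖z - w‖^2 * ((f z).im * (f w).im) := by
  let φ : ℂ → ℂ := fun ζ => (w - (starRingEnd ℂ) w * ζ) / (1 - ζ)
  let h : ℂ → ℂ := fun ζ => (f (φ ζ) - f w) / (f (φ ζ) - (starRingEnd ℂ) (f w))
  have h1 : ∀ ζ ∈ Metric.ball (0:ℂ) 1, (1 - ζ) ≠ 0 := by
    intro ζ hζ h0
    have : ζ = 1 := (sub_eq_zero.1 h0).symm
    simp [this] at hζ
  have hφ : ∀ ζ ∈ Metric.ball (0:ℂ) 1, 0 < (φ ζ).im := by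
    intro ζ hζ
    have h10 := h1 ζ hζ
    have hn : 0 < Complex.normSq (1 - ζ) := Complex.normSq_pos.2 h10
    have hζ' : Complex.normSq ζ < 1 := by
      rw [Complex.normSq_eq_norm_sq]
      have : ‖ζ‖ < 1 := by simpa using hζ
      nlinarith [norm_nonneg ζ]
    have : (φ ζ).im = w.im * (1 - Complex.normSq ζ) / Complex.normSq (1 - ζ) := by
      simp only [φ, Complex.div_im]
      field_simp
      simp [Complex.normSq_apply]; ring
    rw [this]
    have : 0 < 1 - Complex.normSq ζ := by linarith
    positivity
  have hd : DifferentiableOn ℂ h (Metric.ball 0 1) := by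
    intro ζ hζ
    apply DifferentiableAt.differentiableWithinAt
    have e1 : DifferentiableAt ℂ φ ζ := by
      have := h1 ζ hζ
      exact DifferentiableAt.div (by fun_prop) (by fun_prop) this
    have e2 : DifferentiableAt ℂ (fun ζ => f (φ ζ)) ζ :=
      DifferentiableAt.comp ζ (hf _ (hφ ζ hζ)) e1
    exact DifferentiableAt.div (e2.sub_const _) (e2.sub_const _)
      (sub_conj_ne (hm _ (hφ ζ hζ)) (hm _ hw))
  have hmaps : Set.MapsTo h (Metric.ball 0 1) (Metric.closedBall 0 1) := by
    intro ζ hζ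
    have a1 := hm _ (hφ ζ hζ)
    have a2 := hm _ hw
    have hne := sub_conj_ne a1 a2
    simp only [h, mem_closedBall_zero_iff, norm_div]
    rw [div_le_one (norm_pos_iff.2 hne)]
    apply le_of_sq_le_sq _ (norm_nonneg _)
    rw [normSq_conj_id]
    have := mul_pos a1 a2
    linarith
  have h0 : h 0 = 0 := by simp [h, φ]
  have hne := sub_conj_ne hz hw
  have hnf := sub_conj_ne (hm _ hz) (hm _ hw)
  let ζ := (z - w) / (z - (starRingEnd ℂ) w)
  have hlt : ‖ζ‖ < 1 := by
    simp only [ζ, norm_div]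
    rw [div_lt_one (norm_pos_iff.2 hne)]
    apply lt_of_pow_lt_pow_left₀ 2 (norm_nonneg _)
    rw [normSq_conj_id]
    have := mul_pos hz hw
    linarith
  have hφζ : φ ζ = z := by
    have : w - (starRingEnd ℂ) w ≠ 0 := sub_conj_ne hw hw
    have e : 1 - ζ = (w - (starRingEnd ℂ) w) / (z - (starRingEnd ℂ) w) := by
      simp only [ζ]; field_simp; ring
    simp only [φ]
    rw [e]
    simp only [ζ]; field_simp; ring
  have key := Complex.norm_le_norm_of_mapsTo_ball hd hmaps h0 hlt
  simp only [h, hφζ, ζ, norm_div] at key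
  rw [div_le_div_iff₀ (norm_pos_iff.2 hnf) (norm_pos_iff.2 hne)] at key
  have key2 := pow_le_pow_left₀ (by positivity) key 2
  rw [mul_pow, mul_pow, normSq_conj_id, normSq_conj_id] at key2
  nlinarith

lemma julia_taylor (G R : ℂ → ℂ) (y x a b c : ℝ) (hR : ContinuousAt R 0)
    (hT : ∀ w : ℂ, G (y + w) = x + a * w + b * w^2 + c * w^3 + w^4 * R w)
    (hp : ∀ z w : ℂ, 0 < z.im → 0 < w.im →
      ‖G z - G w‖^2 * (z.im * w.im) ≤ ‖z - w‖^2 * ((G z).im * (G w).im)) :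
    b^2 ≤ a * c := by
  have hI : Filter.Tendsto (fun t : ℝ => (t : ℂ) * I) (nhdsWithin 0 (Set.Ioi 0)) (nhds 0) := by
    have : Continuous (fun t : ℝ => (t : ℂ) * I) := by fun_prop
    have := this.tendsto 0
    simp only [ofReal_zero, zero_mul] at this
    exact this.mono_left nhdsWithin_le_nhds
  have hid : Filter.Tendsto (fun t : ℝ => t) (nhdsWithin 0 (Set.Ioi 0)) (nhds 0) :=
    Filter.tendsto_id.mono_left nhdsWithin_le_nhds
  have hRI : Filter.Tendsto (fun t : ℝ => R ((t : ℂ) * I)) (nhdsWithin 0 (Set.Ioi 0)) (nhds (R 0)) :=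
    hR.tendsto.comp hI
  have hre : Filter.Tendsto (fun t : ℝ => (R ((t : ℂ) * I)).re) (nhdsWithin 0 (Set.Ioi 0))
      (nhds (R 0).re) := (Complex.continuous_re.tendsto _).comp hRI
  have him : Filter.Tendsto (fun t : ℝ => (R ((t : ℂ) * I)).im) (nhdsWithin 0 (Set.Ioi 0))
      (nhds (R 0).im) := (Complex.continuous_im.tendsto _).comp hRI
  have hG : ∀ t : ℝ, G (y + t * I) =
      (((x - b * t^2 + t^4 * (R (t * I)).re : ℝ) : ℂ)
        + ((a * t - c * t^3 + t^4 * (R (t * I)).im : ℝ) : ℂ) * I) := by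
    intro t
    rw [hT]
    nth_rewrite 1 [← Complex.re_add_im (R (t * I))]
    have h3 : (I : ℂ)^3 = -I := Complex.I_pow_three
    have h4 : (I : ℂ)^4 = 1 := Complex.I_pow_four
    simp only [mul_pow, h3, h4, Complex.I_sq]
    push_cast
    ring
  have hGre : ∀ t : ℝ, (G (y + t * I)).re = x - b * t^2 + t^4 * (R (t * I)).re := by
    intro t; rw [hG]; simp [-ofReal_add, -ofReal_sub, -ofReal_mul]
  have hGim : ∀ t : ℝ, (G (y + t * I)).im = a * t - c * t^3 + t^4 * (R (t * I)).im := by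
    intro t; rw [hG]; simp [-ofReal_add, -ofReal_sub, -ofReal_mul]
  have hGlim : Filter.Tendsto (fun t : ℝ => G (y + t * I)) (nhdsWithin 0 (Set.Ioi 0)) (nhds x) := by
    simp only [hT]
    have := ((((hI.const_mul (a:ℂ)).const_add (x:ℂ)).add ((hI.pow 2).const_mul (b:ℂ))).add
      ((hI.pow 3).const_mul (c:ℂ))).add ((hI.pow 4).mul hRI)
    simpa using this
  have julia : ∀ z : ℂ, 0 < z.im → ‖G z - x‖^2 * z.im ≤ ‖z - y‖^2 * ((G z).im * a) := by
    intro z hz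
    have l1 : Filter.Tendsto (fun t : ℝ => ‖G z - G (y + t * I)‖^2 * z.im)
        (nhdsWithin 0 (Set.Ioi 0)) (nhds (‖G z - x‖^2 * z.im)) :=
      (((hGlim.const_sub (G z)).norm).pow 2).mul_const _
    have l2 : Filter.Tendsto (fun t : ℝ => ‖z - (y + t * I)‖^2 *
        ((G z).im * (a - c * t^2 + t^3 * (R (t * I)).im)))
        (nhdsWithin 0 (Set.Ioi 0)) (nhds (‖z - (y + 0)‖^2 *
          ((G z).im * (a - c * 0^2 + 0^3 * (R 0).im)))) :=
      ((((hI.const_add (y:ℂ)).const_sub z).norm).pow 2).mul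
        ((((hid.pow 2).const_mul c).const_sub a |>.add ((hid.pow 3).mul him)).const_mul _)
    have := le_of_tendsto_of_tendsto l1 l2 (by
      filter_upwards [self_mem_nhdsWithin] with t ht
      have ht : 0 < t := ht
      have h := hp z (y + t * I) hz (by simpa using ht)
      rw [hGim] at h
      have e : ((y : ℂ) + t * I).im = t := by simp
      rw [e] at h
      apply le_of_mul_le_mul_right _ ht
      calc _ = _ := by ring
        _ ≤ _ := h
        _ = _ := by ring)
    simpa using this
  have fin : Filter.Tendsto (fun t : ℝ => (a - c * t^2 + t^3 * (R (t * I)).im) *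
        (c - t * (R (t * I)).im) - (-b + t^2 * (R (t * I)).re)^2)
      (nhdsWithin 0 (Set.Ioi 0)) (nhds ((a - c * 0^2 + 0^3 * (R 0).im) *
        (c - 0 * (R 0).im) - (-b + 0^2 * (R 0).re)^2)) :=
    (((((hid.pow 2).const_mul c).const_sub a).add ((hid.pow 3).mul him)).mul
      ((hid.mul him).const_sub c)).sub ((((hid.pow 2).mul hre).const_add (-b)).pow 2)
  have := ge_of_tendsto (b := 0) fin (by
      filter_upwards [self_mem_nhdsWithin] with t ht
      have ht : 0 < t := ht
      have h := julia (y + t * I) (by simpa using ht)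
      rw [← Complex.normSq_eq_norm_sq, ← Complex.normSq_eq_norm_sq,
        Complex.normSq_apply, Complex.normSq_apply] at h
      simp only [sub_re, sub_im, hGre, hGim] at h
      simp at h
      have h5 : 0 < t^5 := by positivity
      apply le_of_mul_le_mul_right _ h5
      linear_combination h)
  simp at this
  linarith

lemma derivs (F : ℝ → ℝ) (hF : ContDiffOn ℝ 3 F (Set.Ioi 0)) (x : ℝ) (hx : 0 < x) :
    HasDerivAt F (deriv F x) x ∧ HasDerivAt (deriv F) (deriv (deriv F) x) x ∧
    HasDerivAt (deriv (deriv F)) (deriv (deriv (deriv F)) x) x := by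
  have h1 : ContDiffOn ℝ 2 (deriv F) (Set.Ioi 0) := hF.deriv_of_isOpen isOpen_Ioi (by norm_num)
  have h2 : ContDiffOn ℝ 1 (deriv (deriv F)) (Set.Ioi 0) :=
    h1.deriv_of_isOpen isOpen_Ioi (by norm_num)
  have hn := Ioi_mem_nhds hx
  exact ⟨((hF.differentiableOn (by norm_num)).differentiableAt hn).hasDerivAt,
    ((h1.differentiableOn (by norm_num)).differentiableAt hn).hasDerivAt,
    ((h2.differentiableOn (by norm_num)).differentiableAt hn).hasDerivAt⟩

/-- If a `C³` map `F` on `(0,∞)` with positive derivative and positive values has an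
inverse branch admitting a conformal extension of the slit plane into itself, then the
Schwarzian derivative of `F` is non-positive on `(0,∞)`. -/
theorem schwarzian_nonpos_of_epstein
    (F : ℝ → ℝ)
    (hF : ContDiffOn ℝ 3 F (Set.Ioi 0))
    (hF' : ∀ x : ℝ, 0 < x → 0 < deriv F x)
    (hFpos : ∀ x : ℝ, 0 < x → 0 < F x)
    (G : ℂ → ℂ)
    (hG : ∀ z ∈ Complex.slitPlane, DifferentiableAt ℂ G z)
    (hinj : Set.InjOn G Complex.slitPlane)
    (hmaps : Set.MapsTo G Complex.slitPlane Complex.slitPlane)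
    (hGF : ∀ x : ℝ, 0 < x → G ((F x : ℝ) : ℂ) = (x : ℂ)) :
    ∀ x : ℝ, 0 < x →
      deriv (deriv (deriv F)) x / deriv F x
          - (3 / 2) * (deriv (deriv F) x / deriv F x) ^ 2 ≤ 0 := by
  intro x hx
  have hopen := Complex.isOpen_slitPlane
  have hGan : AnalyticOnNhd ℂ G slitPlane :=
    DifferentiableOn.analyticOnNhd (fun z hz => (hG z hz).differentiableWithinAt) hopen
  have hG1an := hGan.deriv
  have hG2an := hG1an.deriv
  have hmem : ∀ x : ℝ, 0 < x → ((F x : ℝ) : ℂ) ∈ slitPlane := fun x hx => by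
    simpa using hFpos x hx
  -- chain rule
  have chain : ∀ (K : ℂ → ℂ), AnalyticOnNhd ℂ K slitPlane → ∀ t : ℝ, 0 < t →
      HasDerivAt (fun s : ℝ => K (F s)) (deriv K (F t) * (deriv F t : ℝ)) t := by
    intro K hK t ht
    have h1 := (derivs F hF t ht).1.ofReal_comp
    have h2 := (hK _ (hmem t ht)).differentiableAt.hasDerivAt
    have := HasDerivAt.scomp (h := fun s : ℝ => ((F s : ℝ) : ℂ)) t h2 h1
    simpa [Function.comp_def, mul_comm] using this
  have r1 : ∀ t : ℝ, 0 < t → deriv G (F t) * (deriv F t : ℝ) = 1 := by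
    intro t ht
    have h1 := chain G hGan t ht
    have h2 : HasDerivAt (fun s : ℝ => (s : ℂ)) 1 t := by
      simpa using (hasDerivAt_id t).ofReal_comp
    refine h1.unique (h2.congr_of_eventuallyEq ?_)
    filter_upwards [Ioi_mem_nhds ht] with s hs using hGF s hs
  have r2 : ∀ t : ℝ, 0 < t → deriv (deriv G) (F t) * (deriv F t : ℝ) * (deriv F t : ℝ)
      + deriv G (F t) * (deriv (deriv F) t : ℝ) = 0 := by
    intro t ht
    have h1 := (chain _ hG1an t ht).mul (derivs F hF t ht).2.1.ofReal_comp
    refine h1.unique ((hasDerivAt_const t (1:ℂ)).congr_of_eventuallyEq ?_)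
    filter_upwards [Ioi_mem_nhds ht] with s hs using r1 s hs
  have r3 : ∀ t : ℝ, 0 < t → (deriv (deriv (deriv G)) (F t) * (deriv F t : ℝ) * (deriv F t : ℝ)
        + deriv (deriv G) (F t) * (deriv (deriv F) t : ℝ)) * (deriv F t : ℝ)
      + deriv (deriv G) (F t) * (deriv F t : ℝ) * (deriv (deriv F) t : ℝ)
      + (deriv (deriv G) (F t) * (deriv F t : ℝ) * (deriv (deriv F) t : ℝ)
        + deriv G (F t) * (deriv (deriv (deriv F)) t : ℝ)) = 0 := by
    intro t ht
    have d := derivs F hF t ht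
    have h1 := (((chain _ hG2an t ht).mul d.2.1.ofReal_comp).mul d.2.1.ofReal_comp).add
      ((chain _ hG1an t ht).mul d.2.2.ofReal_comp)
    refine h1.unique ((hasDerivAt_const t (0:ℂ)).congr_of_eventuallyEq ?_)
    filter_upwards [Ioi_mem_nhds ht] with s hs using r2 s hs
  have hp := hF' x hx
  have hpc : ((deriv F x : ℝ) : ℂ) ≠ 0 := by exact_mod_cast hp.ne'
  set p := deriv F x with hpdef
  set q := deriv (deriv F) x with hqdef
  set u := deriv (deriv (deriv F)) x with hudef
  have g1 : deriv G (F x) = ((1 / p : ℝ) : ℂ) := by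
    push_cast
    rw [eq_div_iff hpc]
    exact r1 x hx
  have g2 : deriv (deriv G) (F x) = ((-q / p^3 : ℝ) : ℂ) := by
    have := r2 x hx
    rw [g1] at this
    push_cast at this ⊢
    field_simp at this ⊢
    linear_combination this
  have g3 : deriv (deriv (deriv G)) (F x) = (((3 * q^2 - u * p) / p^5 : ℝ) : ℂ) := by
    have := r3 x hx
    rw [g1, g2, ← hpdef, ← hqdef, ← hudef] at this
    push_cast at this ⊢
    field_simp at this ⊢
    linear_combination this
  -- Taylor
  obtain ⟨R, hRan, hR⟩ : ∃ R : ℂ → ℂ, AnalyticAt ℂ R 0 ∧ ∀ w : ℂ, G ((F x : ℝ) + w) =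
      (x : ℝ) + ((1 / p : ℝ) : ℂ) * w + ((-q / p^3 / 2 : ℝ) : ℂ) * w^2 +
      (((3 * q^2 - u * p) / p^5 / 6 : ℝ) : ℂ) * w^3 + w^4 * R w := by
    have han : AnalyticAt ℂ (fun w => G ((F x : ℝ) + w)) 0 := by
      apply AnalyticAt.fun_comp (g := G) _ (by fun_prop)
      simpa using hGan _ (hmem x hx)
    obtain ⟨R, h1, h2⟩ := han.exists_eq_sum_add_pow_mul 4
    refine ⟨R, h1, fun w => ?_⟩
    rw [h2 w]
    simp only [iteratedDeriv_comp_const_add]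
    simp only [Finset.sum_range_succ, Finset.sum_range_zero, iteratedDeriv_succ, iteratedDeriv_zero,
      add_zero, hGF x hx, g1, g2, g3]
    simp [Nat.factorial]
    ring
  -- symmetry
  have hcm : ∀ z ∈ slitPlane, (starRingEnd ℂ) z ∈ slitPlane := by
    intro z hz
    rw [mem_slitPlane_iff] at hz ⊢
    simpa using hz
  have hsym : Set.EqOn G (starRingEnd ℂ ∘ G ∘ starRingEnd ℂ) slitPlane := by
    have han2 : AnalyticOnNhd ℂ (starRingEnd ℂ ∘ G ∘ starRingEnd ℂ) slitPlane :=
      DifferentiableOn.analyticOnNhd (fun z hz =>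
        (differentiableAt_conj_conj_iff.2 (hG _ (hcm z hz))).differentiableWithinAt) hopen
    have hconn : IsPreconnected slitPlane :=
      (starConvex_one_slitPlane.isPathConnected one_mem_slitPlane).isConnected.isPreconnected
    refine hGan.eqOn_of_preconnected_of_frequently_eq han2 hconn (hmem x hx) ?_
    have ht : Filter.Tendsto (fun t : ℝ => ((F t : ℝ) : ℂ)) (nhdsWithin x (Set.Ioi x))
        (nhdsWithin ((F x : ℝ) : ℂ) {((F x : ℝ) : ℂ)}ᶜ) := by
      apply tendsto_nhdsWithin_of_tendsto_nhds_of_eventually_within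
      · exact ((derivs F hF x hx).1.ofReal_comp.continuousAt.tendsto).mono_left nhdsWithin_le_nhds
      · filter_upwards [self_mem_nhdsWithin] with t ht h
        have ht : x < t := ht
        have h : ((F t : ℝ) : ℂ) = ((F x : ℝ) : ℂ) := h
        have h1 := hGF t (hx.trans ht)
        rw [h, hGF x hx] at h1
        exact ht.ne (by exact_mod_cast h1)
    apply ht.frequently
    apply Filter.Eventually.frequently
    filter_upwards [self_mem_nhdsWithin] with t ht
    have ht : x < t := ht
    simp [hGF t (hx.trans ht)]
  have hne : ∀ z : ℂ, 0 < z.im → (G z).im ≠ 0 := by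
    intro z hz h0
    have hzs : z ∈ slitPlane := mem_slitPlane_iff.2 (Or.inr hz.ne')
    have h1 := hsym (hcm z hzs)
    simp only [Function.comp_apply, Complex.conj_conj, Complex.conj_eq_iff_im.2 h0] at h1
    have h2 := hinj (hcm z hzs) hzs h1
    have := Complex.conj_eq_iff_im.1 h2
    exact hz.ne' this
  have hups : ∀ z : ℂ, 0 < z.im → z ∈ slitPlane := fun z hz =>
    mem_slitPlane_iff.2 (Or.inr hz.ne')
  have hex : ∃ z : ℂ, 0 < z.im ∧ 0 < (G z).im := by
    have hd : HasDerivAt (fun t : ℝ => G ((F x : ℝ) + t * I)) (((1 / p : ℝ) : ℂ) * I) 0 := by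
      have h1 : HasDerivAt (fun w : ℂ => ((F x : ℝ) : ℂ) + w * I) I ((0 : ℝ) : ℂ) := by
        simpa using ((hasDerivAt_id ((0 : ℝ) : ℂ)).mul_const I).const_add ((F x : ℝ) : ℂ)
      have h2 : HasDerivAt G ((1 / p : ℝ) : ℂ) (((F x : ℝ) : ℂ) + ((0 : ℝ) : ℂ) * I) := by
        rw [← g1]
        simpa using (hG _ (hmem x hx)).hasDerivAt
      exact (HasDerivAt.comp (h := fun w : ℂ => ((F x : ℝ) : ℂ) + w * I) _ h2 h1).comp_ofReal
    have him : HasDerivAt (fun t : ℝ => (G ((F x : ℝ) + t * I)).im) (1 / p) 0 := by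
      have := (Complex.imCLM.hasFDerivAt (x := G ((F x : ℝ) + (0:ℝ) * I))).comp_hasDerivAt (0:ℝ) hd
      simpa [Function.comp_def, -one_div, -ofReal_div] using this
    have := him.tendsto_slope_zero_right.eventually (lt_mem_nhds (show (0:ℝ) < 1 / p by positivity))
    obtain ⟨t, h1, h2⟩ := (this.and self_mem_nhdsWithin).exists
    have h2 : 0 < t := h2
    refine ⟨(F x : ℝ) + t * I, by simpa using h2, ?_⟩
    simp [hGF x hx] at h1
    rcases (pos_iff_pos_of_mul_pos h1) with h3
    exact h3.1 (by positivity)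
  have hpos : ∀ z : ℂ, 0 < z.im → 0 < (G z).im := by
    obtain ⟨z0, hz0, hz0'⟩ := hex
    intro z hz
    by_contra hcon
    have hpre : IsPreconnected {c : ℂ | 0 < c.im} := (convex_halfSpace_im_gt 0).isPreconnected
    have hcont : ContinuousOn (fun z => (G z).im) {c : ℂ | 0 < c.im} := by
      intro w hw
      exact (Complex.continuous_im.continuousAt.comp
        (hG w (hups w hw)).continuousAt).continuousWithinAt
    obtain ⟨w, hw, hw0⟩ := hpre.intermediate_value (a := z) (b := z0) hz hz0 hcont
      ⟨not_lt.1 hcon, hz0'.le⟩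
    exact hne w hw hw0
  have main := julia_taylor G R (F x) x (1 / p) (-q / p^3 / 2) ((3 * q^2 - u * p) / p^5 / 6)
    hRan.continuousAt hR (fun z w hz hw => pick G (fun z hz => hG z (hups z hz)) hpos z w hz hw)
  have e : u / p - 3 / 2 * (q / p)^2 =
      6 * p^4 * ((-q / p^3 / 2)^2 - 1 / p * ((3 * q^2 - u * p) / p^5 / 6)) := by
    field_simp
    ring
  rw [e]
  have : 0 < 6 * p^4 := by positivity
  nlinarith
end

section
/- (No wandering intervals for analytic circle maps, the analytic case of the paper's No Wandering Intervals Theorem for quasicritical circle maps.) Let F : ℝ → ℝ be real-analytic, strictly increasing, and satisfy F(x+1) = F(x) + 1 for all x ∈ ℝ (so F is the lift of an orientation-preserving analytic homeomorphism of the circle ℝ/ℤ; zeros of F′, i.e. critical points, are allowed). Assume the induced circle map has no periodic points: for all x ∈ ℝ, all integers n ≥ 1 and all m ∈ ℤ, Fⁿ(x) ≠ x + m. Then the circle map has no wandering interval: there is no nonempty open interval J = (a,b) with b − a < 1 such that for every n ≥ 1 and every m ∈ ℤ the sets Fⁿ(J) and J + m are disjoint. -/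
open Set Filter Topology

noncomputable def crE (a b c d : ℝ) : ℝ := (c - a) * (d - b) / ((b - a) * (d - c))

lemma crE_pos {a b c d : ℝ} (h1 : a < b) (h2 : b < c) (h3 : c < d) : 0 < crE a b c d := by
  unfold crE
  have : 0 < c - a := by linarith
  have : 0 < d - b := by linarith
  have : 0 < b - a := by linarith
  have : 0 < d - c := by linarith
  positivity

lemma geom_ineq (K : ℕ) (a b c d : ℝ) (ha : 0 ≤ a) (hab : a ≤ b) (hbc : b ≤ c) (hcd : c ≤ d) :
    (∑ i ∈ Finset.range (K+1), b^i * a^(K-i)) * (∑ i ∈ Finset.range (K+1), d^i * c^(K-i)) ≤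
    (∑ i ∈ Finset.range (K+1), c^i * a^(K-i)) * (∑ i ∈ Finset.range (K+1), d^i * b^(K-i)) := by
  -- RHS - LHS = sum over i j of a^(K-i) d^j (c^i b^(K-j) - b^i c^(K-j))
  have hb : 0 ≤ b := ha.trans hab
  have hc : 0 ≤ c := hb.trans hbc
  have hd : 0 ≤ d := hc.trans hcd
  have had : a ≤ d := hab.trans (hbc.trans hcd)
  set S : ℝ := ∑ i ∈ Finset.range (K+1), ∑ j ∈ Finset.range (K+1),
    a^(K-i) * d^j * (c^i * b^(K-j) - b^i * c^(K-j)) with hS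
  have e1 : S = (∑ i ∈ Finset.range (K+1), c^i * a^(K-i)) * (∑ i ∈ Finset.range (K+1), d^i * b^(K-i))
     - (∑ i ∈ Finset.range (K+1), b^i * a^(K-i)) * (∑ i ∈ Finset.range (K+1), d^i * c^(K-i)) := by
    rw [Finset.sum_mul_sum, Finset.sum_mul_sum, ← Finset.sum_sub_distrib, hS]
    refine Finset.sum_congr rfl fun i _ => ?_
    rw [← Finset.sum_sub_distrib]
    refine Finset.sum_congr rfl fun j _ => ?_
    ring
  have e2 : S = ∑ i ∈ Finset.range (K+1), ∑ j ∈ Finset.range (K+1),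
    a^(j) * d^(K-i) * (c^(K-j) * b^(i) - b^(K-j) * c^(i)) := by
    rw [hS, Finset.sum_comm, ← Finset.sum_range_reflect]
    refine Finset.sum_congr rfl fun i hi => ?_
    rw [← Finset.sum_range_reflect]
    refine Finset.sum_congr rfl fun j hj => ?_
    have hi := Finset.mem_range.1 hi
    have hj := Finset.mem_range.1 hj
    have h1 : K + 1 - 1 - i = K - i := by omega
    have h2 : K + 1 - 1 - j = K - j := by omega
    have h3 : K - (K - i) = i := by omega
    have h4 : K - (K - j) = j := by omega
    rw [h1, h2, h3, h4]
  have e3 : 0 ≤ S + S := by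
    nth_rewrite 2 [e2]
    rw [hS]
    rw [← Finset.sum_add_distrib]
    refine Finset.sum_nonneg fun i hi => ?_
    rw [← Finset.sum_add_distrib]
    refine Finset.sum_nonneg fun j hj => ?_
    have hi := Finset.mem_range.1 hi
    have hj := Finset.mem_range.1 hj
    have : a^(K-i) * d^j * (c^i * b^(K-j) - b^i * c^(K-j)) + a^(j) * d^(K-i) * (c^(K-j) * b^(i) - b^(K-j) * c^(i))
      = (a^(K-i) * d^j - a^j * d^(K-i)) * (c^i * b^(K-j) - b^i * c^(K-j)) := by ring
    rw [this]
    have key : ∀ (x y : ℝ) (p q : ℕ), 0 ≤ x → x ≤ y → p ≤ q → x^q * y^p ≤ x^p * y^q := by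
      intro x y p q hx hxy hpq
      obtain ⟨r, rfl⟩ := Nat.exists_eq_add_of_le hpq
      have := pow_le_pow_left₀ hx hxy r
      have h0 : 0 ≤ x^p * y^p := mul_nonneg (pow_nonneg hx _) (pow_nonneg (hx.trans hxy) _)
      calc x^(p+r) * y^p = x^p*y^p * x^r := by ring
        _ ≤ x^p*y^p * y^r := by gcongr
        _ = _ := by ring
    rcases le_total (K - i) j with h | h
    · have h' : K - j ≤ i := by omega
      apply mul_nonneg
      · linarith [key a d _ _ ha had h]
      · linarith [key b c _ _ hb hbc h', mul_comm (c^i) (b^(K-j))]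
    · have h' : i ≤ K - j := by omega
      apply mul_nonneg_of_nonpos_of_nonpos
      · linarith [key a d _ _ ha had h]
      · linarith [key b c _ _ hb hbc h', mul_comm (c^i) (b^(K-j))]
  linarith

lemma pow_cr (K : ℕ) {a b c d : ℝ} (ha : 0 ≤ a) (hab : a < b) (hbc : b < c) (hcd : c < d) :
    crE a b c d ≤ crE (a^(K+1)) (b^(K+1)) (c^(K+1)) (d^(K+1)) := by
  have f : ∀ x y : ℝ, y^(K+1) - x^(K+1) = (∑ i ∈ Finset.range (K+1), y^i * x^(K-i)) * (y - x) := by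
    intro x y
    rw [← geom_sum₂_mul]
    simp
  have hb : 0 < b := by linarith
  have hc : 0 < c := by linarith
  have hd : 0 < d := by linarith
  have pos : ∀ x y : ℝ, 0 ≤ x → 0 < y → 0 < (∑ i ∈ Finset.range (K+1), y^i * x^(K-i)) := by
    intro x y hx hy
    have : ∀ i ∈ Finset.range (K+1), 0 ≤ y^i * x^(K-i) := fun i _ => by positivity
    refine lt_of_lt_of_le ?_ (Finset.single_le_sum this (Finset.self_mem_range_succ K))
    simp; positivity
  have g := geom_ineq K a b c d ha hab.le hbc.le hcd.le
  unfold crE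
  rw [f, f, f, f]
  have p1 := pos a b ha hb
  have p2 := pos c d hc.le hd
  set s1 := (∑ i ∈ Finset.range (K+1), b^i * a^(K-i))
  set s2 := (∑ i ∈ Finset.range (K+1), d^i * c^(K-i))
  set s3 := (∑ i ∈ Finset.range (K+1), c^i * a^(K-i))
  set s4 := (∑ i ∈ Finset.range (K+1), d^i * b^(K-i))
  have q1 : 0 < b - a := by linarith
  have q2 : 0 < d - c := by linarith
  have q3 : 0 < c - a := by linarith
  have q4 : 0 < d - b := by linarith
  rw [div_le_div_iff₀ (by positivity) (by positivity)]
  have : 0 ≤ (c-a)*(d-b)*((b-a)*(d-c)) := by positivity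
  nlinarith [mul_le_mul_of_nonneg_left g this]

/-- local structure -/
lemma local_struct (F : ℝ → ℝ) (hA : ∀ x : ℝ, AnalyticAt ℝ F x) (hmono : StrictMono F) (c : ℝ) :
    ∃ ε > 0, ∃ k : ℕ, ∃ g : ℝ → ℝ, ∃ K ≥ 0, ∀ x, |x - c| < ε →
      deriv F x = |x - c| ^ k * Real.exp (g x) ∧ ∀ y, |y - c| < ε → |g x - g y| ≤ K * |x - y| := by
  have hd : AnalyticAt ℝ (deriv F) c := (hA c).deriv
  have hdiff : Differentiable ℝ F := fun x => (hA x).differentiableAt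
  have hnz : ¬ ∀ᶠ z in 𝓝 c, deriv F z = 0 := by
    intro h
    obtain ⟨ε, hε, hb⟩ := Metric.eventually_nhds_iff.1 h
    obtain ⟨ξ, hξ, e⟩ := exists_deriv_eq_slope F (show c < c + ε/2 by linarith)
      hdiff.continuous.continuousOn hdiff.differentiableOn
    rw [hb (by rw [Real.dist_eq, abs_lt]; constructor <;> linarith [hξ.1, hξ.2])] at e
    have h1 := hmono (show c < c + ε/2 by linarith)
    have : 0 < (F (c+ε/2) - F c) / (c+ε/2 - c) := div_pos (by linarith) (by linarith)
    linarith
  obtain ⟨k, H, hH, hH0, hev⟩ := (hd.exists_eventuallyEq_pow_smul_nonzero_iff).2 hnz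
  have hne : ∀ᶠ z in 𝓝 c, H z ≠ 0 := hH.continuousAt.eventually_ne hH0
  have hC : ContDiffAt ℝ 1 (fun x => Real.log (H x)) c :=
    (hH.contDiffAt).log hH0
  obtain ⟨K, s, hs, hL⟩ := hC.exists_lipschitzOnWith
  obtain ⟨ε, hε, hb⟩ := Metric.eventually_nhds_iff.1 (hev.and (hne.and hs))
  refine ⟨ε, hε, k, fun x => Real.log (H x), K, K.2, fun x hx => ⟨?_, fun y hy => ?_⟩⟩
  · obtain ⟨h1, h2, -⟩ := hb (show dist x c < ε by rwa [Real.dist_eq])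
    have : 0 ≤ deriv F x := hmono.monotone.deriv_nonneg
    rw [← abs_of_nonneg this, h1, smul_eq_mul, abs_mul, abs_pow, Real.exp_log_eq_abs h2]
  · have h1 := (hb (show dist x c < ε by rwa [Real.dist_eq])).2.2
    have h2 := (hb (show dist y c < ε by rwa [Real.dist_eq])).2.2
    have := hL.dist_le_mul x h1 y h2
    rwa [Real.dist_eq, Real.dist_eq] at this
lemma lemA_local (F : ℝ → ℝ) (hA : ∀ x : ℝ, AnalyticAt ℝ F x) (hmono : StrictMono F) (c : ℝ) :
    ∃ ε > 0, ∃ c0 > 0, ∀ x z y, |x - c| < ε → |y - c| < ε → x ≤ z → z ≤ y →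
      c0 * deriv F z * (y - x) ≤ F y - F x := by
  obtain ⟨ε, hε, k, g, K, hK, h⟩ := local_struct F hA hmono c
  have hdiff : Differentiable ℝ F := fun x => (hA x).differentiableAt
  refine ⟨ε, hε, Real.exp (-(2*(K*ε))) / (4 * 2^k), by positivity, ?_⟩
  intro x z y hx hy hxz hzy
  rcases eq_or_lt_of_le (hxz.trans hzy) with rfl | hxy
  · simp
  have hz : |z - c| < ε := by
    rw [abs_lt] at *; constructor <;> linarith
  have hcc : |c - c| < ε := by simpa using hε
  set u := max |x - c| |y - c| with hu
  have hzu : |z - c| ≤ u := by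
    rw [hu, abs_le]
    constructor
    · have := neg_abs_le (x - c); have := le_max_left |x - c| |y - c|; linarith
    · have := le_abs_self (y - c); have := le_max_right |x - c| |y - c|; linarith
  have hu0 : 0 ≤ u := (abs_nonneg _).trans hzu
  -- subinterval
  obtain ⟨x', y', hxx, hyy, hlen, hsub⟩ : ∃ x' y', x ≤ x' ∧ y' ≤ y ∧ y' - x' = (y - x)/4 ∧
      ∀ t ∈ Ioo x' y', u / 2 ≤ |t - c| := by
    rcases le_total |x - c| |y - c| with hc | hc
    · have hyc : 0 ≤ y - c := by
        by_contra hneg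
        push Not at hneg
        rw [abs_of_neg hneg, abs_of_neg (by linarith)] at hc
        linarith
      have hu' : u = y - c := by rw [hu, max_eq_right hc, abs_of_nonneg hyc]
      have hx' : -(y - c) ≤ x - c := by
        have := neg_abs_le (x - c); rw [abs_of_nonneg hyc] at hc; linarith
      refine ⟨y - (y-x)/4, y, by linarith, le_rfl, by ring, fun t ht => ?_⟩
      refine le_trans ?_ (le_abs_self _)
      rw [hu']; linarith [ht.1]
    · have hyc : x - c ≤ 0 := by
        by_contra hneg
        push Not at hneg
        rw [abs_of_pos hneg, abs_of_pos (by linarith)] at hc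
        linarith
      have hu' : u = -(x - c) := by rw [hu, max_eq_left hc, abs_of_nonpos hyc]
      have hx' : y - c ≤ -(x - c) := by
        have := le_abs_self (y - c); rw [abs_of_nonpos hyc] at hc; linarith
      refine ⟨x, x + (y-x)/4, le_rfl, by linarith, by ring, fun t ht => ?_⟩
      refine le_trans ?_ (neg_le_abs _)
      rw [hu']; linarith [ht.2]
  have hlt : x' < y' := by linarith
  obtain ⟨ξ, hξ, e⟩ := exists_deriv_eq_slope F hlt
      hdiff.continuous.continuousOn hdiff.differentiableOn
  have hξc : |ξ - c| < ε := by
    rw [abs_lt] at *; constructor <;> linarith [hξ.1, hξ.2]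
  rw [eq_div_iff (by linarith), (h ξ hξc).1, hlen] at e
  have hF : F y' - F x' ≤ F y - F x := by
    linarith [hmono.monotone hxx, hmono.monotone hyy]
  refine le_trans ?_ hF
  rw [← e, (h z hz).1]
  have b1 : |z - c|^k ≤ u^k := by gcongr
  have b2 : (u/2)^k ≤ |ξ - c|^k := by gcongr; exact hsub ξ hξ
  have b3 : Real.exp (-(2*(K*ε))) * Real.exp (g z) ≤ Real.exp (g ξ) := by
    rw [← Real.exp_add]
    apply Real.exp_le_exp.2
    have h1 := (h z hz).2 c hcc
    have h2 := (h ξ hξc).2 c hcc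
    have h3 : K * |z - c| ≤ K * ε := by gcongr
    have h4 : K * |ξ - c| ≤ K * ε := by gcongr
    have := (abs_le.1 (h1.trans h3)).2
    have := (abs_le.1 (h2.trans h4)).1
    linarith
  have hyx : 0 ≤ (y - x)/4 := by linarith
  calc Real.exp (-(2*(K*ε))) / (4 * 2^k) * (|z - c|^k * Real.exp (g z)) * (y - x)
      = (|z - c|^k / 2^k) * (Real.exp (-(2*(K*ε))) * Real.exp (g z)) * ((y-x)/4) := by
        field_simp
    _ ≤ (u^k / 2^k) * (Real.exp (g ξ)) * ((y-x)/4) := by gcongr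
    _ = (u/2)^k * (Real.exp (g ξ)) * ((y-x)/4) := by rw [div_pow]
    _ ≤ _ := by gcongr

lemma crE_dist {F V : ℝ → ℝ} {a b c d e1 e2 e3 e4 s : ℝ} 
    (ha : V a < V b) (hb : V b < V c) (hc : V c < V d)
    (h1 : F c - F a = Real.exp e1 * (V c - V a)) (h2 : F d - F b = Real.exp e2 * (V d - V b))
    (h3 : F b - F a = Real.exp e3 * (V b - V a)) (h4 : F d - F c = Real.exp e4 * (V d - V c))
    (hs : e3 + e4 - s ≤ e1 + e2) :
    Real.exp (-s) * crE (V a) (V b) (V c) (V d) ≤ crE (F a) (F b) (F c) (F d) := by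
  have hp := crE_pos ha hb hc
  have : crE (F a) (F b) (F c) (F d) = Real.exp (e1 + e2 - e3 - e4) * crE (V a) (V b) (V c) (V d) := by
    unfold crE
    rw [h1, h2, h3, h4, Real.exp_sub, Real.exp_sub, Real.exp_add]
    have : V b - V a ≠ 0 := by linarith
    have : V d - V c ≠ 0 := by linarith
    field_simp
  rw [this]
  gcongr
  linarith

lemma lemB_local (F : ℝ → ℝ) (hA : ∀ x : ℝ, AnalyticAt ℝ F x) (hmono : StrictMono F) (o : ℝ) :
    ∃ ε > 0, ∃ K ≥ 0, ∀ a b c d, |a - o| < ε → |d - o| < ε → a < b → b < c → c < d →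
      (d ≤ o ∨ o ≤ a) →
      Real.exp (-(K * (d - a))) * crE a b c d ≤ crE (F a) (F b) (F c) (F d) := by
  obtain ⟨ε, hε, k, g, K, hK, h⟩ := local_struct F hA hmono o
  have hdiff : Differentiable ℝ F := fun x => (hA x).differentiableAt
  refine ⟨ε, hε, 2 * K, by positivity, ?_⟩
  intro a b c d ha hd hab hbc hcd hor
  -- main reduction
  have main : ∀ V : ℝ → ℝ, Continuous V → (∀ t, a ≤ t → t ≤ d → HasDerivAt V (|t - o|^k) t) →
      V a < V b → V b < V c → V c < V d → crE a b c d ≤ crE (V a) (V b) (V c) (V d) →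
      Real.exp (-(2 * K * (d - a))) * crE a b c d ≤ crE (F a) (F b) (F c) (F d) := by
    intro V hVc hV v1 v2 v3 hcr
    have rat : ∀ x y, a ≤ x → x < y → y ≤ d → ∃ ξ, (a < ξ ∧ ξ < d) ∧
        F y - F x = Real.exp (g ξ) * (V y - V x) := by
      intro x y hx hxy hy
      obtain ⟨ξ, hξ, e⟩ := exists_ratio_hasDerivAt_eq_ratio_slope F (deriv F) hxy
        hdiff.continuous.continuousOn (fun t _ => (hdiff t).hasDerivAt) V (fun t => |t - o|^k)
        hVc.continuousOn (fun t ht => hV t (by linarith [ht.1]) (by linarith [ht.2]))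
      have hξc : |ξ - o| < ε := by
        rw [abs_lt] at *; constructor <;> linarith [hξ.1, hξ.2]
      refine ⟨ξ, ⟨by linarith [hξ.1], by linarith [hξ.2]⟩, ?_⟩
      have hne : ξ - o ≠ 0 := by
        rcases hor with h | h
        · exact ne_of_lt (by linarith [hξ.2])
        · exact ne_of_gt (by linarith [hξ.1])
      have : |ξ - o|^k ≠ 0 := pow_ne_zero _ (abs_ne_zero.2 hne)
      rw [(h ξ hξc).1] at e
      apply mul_right_cancel₀ this
      linarith
    obtain ⟨ξ1, i1, r1⟩ := rat a c le_rfl (by linarith) (by linarith)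
    obtain ⟨ξ2, i2, r2⟩ := rat b d (by linarith) (by linarith) (by linarith)
    obtain ⟨ξ3, i3, r3⟩ := rat a b le_rfl (by linarith) (by linarith)
    obtain ⟨ξ4, i4, r4⟩ := rat c d (by linarith) (by linarith) (by linarith)
    have lip : ∀ x y, (a < x ∧ x < d) → (a < y ∧ y < d) → g x - g y ≤ K * (d - a) := by
      intro x y hx hy
      have hx' : |x - o| < ε := by rw [abs_lt] at *; constructor <;> linarith
      have hy' : |y - o| < ε := by rw [abs_lt] at *; constructor <;> linarith
      have h1 := (h x hx').2 y hy'
      have h2 : |x - y| ≤ d - a := by rw [abs_le]; constructor <;> linarith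
      have h3 : K * |x - y| ≤ K * (d - a) := by gcongr
      linarith [le_abs_self (g x - g y)]
    have := crE_dist (s := 2 * K * (d - a)) v1 v2 v3 r1 r2 r3 r4
      (by linarith [lip ξ3 ξ1 i3 i1, lip ξ4 ξ2 i4 i2])
    refine le_trans ?_ this
    gcongr
  have hk : (0:ℝ) < k + 1 := by positivity
  rcases hor with h | h
  · refine main (fun t => - ((o - t)^(k+1) / (k+1))) (by fun_prop) ?_ ?_ ?_ ?_ ?_
    · intro t h1 h2
      have h3 : HasDerivAt (fun t : ℝ => o - t) (-1) t := by
        simpa using (hasDerivAt_id t).const_sub o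
      have := ((h3.pow (k+1)).div_const ((k:ℝ)+1)).neg
      have e : |t - o|^k = -(((k + 1 : ℕ) : ℝ) * (o - t) ^ (k + 1 - 1) * -1 / ((k:ℝ) + 1)) := by
        rw [abs_sub_comm, abs_of_nonneg (by linarith)]
        push_cast
        simp
        field_simp
      rw [e]; exact this
    · have : (o - b)^(k+1) < (o - a)^(k+1) := pow_lt_pow_left₀ (by linarith) (by linarith) (by simp)
      simp only [neg_lt_neg_iff]; gcongr
    · have : (o - c)^(k+1) < (o - b)^(k+1) := pow_lt_pow_left₀ (by linarith) (by linarith) (by simp)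
      simp only [neg_lt_neg_iff]; gcongr
    · have : (o - d)^(k+1) < (o - c)^(k+1) := pow_lt_pow_left₀ (by linarith) (by linarith) (by simp)
      simp only [neg_lt_neg_iff]; gcongr
    · have := pow_cr k (a := o - d) (b := o - c) (c := o - b) (d := o - a)
        (by linarith) (by linarith) (by linarith) (by linarith)
      convert this using 1
      · unfold crE; congr 1 <;> ring
      · unfold crE
        rw [show ∀ x y : ℝ, -(x / (k+1)) - -(y/(k+1)) = (y - x) / (k+1) by intros; ring]
        rw [show ∀ x y : ℝ, -(x / (k+1)) - -(y/(k+1)) = (y - x) / (k+1) by intros; ring]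
        rw [show ∀ x y : ℝ, -(x / (k+1)) - -(y/(k+1)) = (y - x) / (k+1) by intros; ring]
        rw [show ∀ x y : ℝ, -(x / (k+1)) - -(y/(k+1)) = (y - x) / (k+1) by intros; ring]
        rw [div_mul_div_comm, div_mul_div_comm, div_div_div_cancel_right₀ (by positivity)]
        congr 1 <;> ring
  · refine main (fun t => ((t - o)^(k+1) / (k+1))) (by fun_prop) ?_ ?_ ?_ ?_ ?_
    · intro t h1 h2
      have h3 : HasDerivAt (fun t : ℝ => t - o) (1) t := by
        simpa using (hasDerivAt_id t).sub_const o
      have := ((h3.pow (k+1)).div_const ((k:ℝ)+1))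
      have e : |t - o|^k = (((k + 1 : ℕ) : ℝ) * (t - o) ^ (k + 1 - 1) * 1 / ((k:ℝ) + 1)) := by
        rw [abs_of_nonneg (by linarith)]
        push_cast
        simp
        field_simp
      rw [e]; exact this
    · have : (a - o)^(k+1) < (b - o)^(k+1) := pow_lt_pow_left₀ (by linarith) (by linarith) (by simp)
      show _ / ((k:ℝ)+1) < _ / ((k:ℝ)+1); gcongr
    · have : (b - o)^(k+1) < (c - o)^(k+1) := pow_lt_pow_left₀ (by linarith) (by linarith) (by simp)
      show _ / ((k:ℝ)+1) < _ / ((k:ℝ)+1); gcongr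
    · have : (c - o)^(k+1) < (d - o)^(k+1) := pow_lt_pow_left₀ (by linarith) (by linarith) (by simp)
      show _ / ((k:ℝ)+1) < _ / ((k:ℝ)+1); gcongr
    · have := pow_cr k (a := a - o) (b := b - o) (c := c - o) (d := d - o)
        (by linarith) (by linarith) (by linarith) (by linarith)
      convert this using 1
      · unfold crE; congr 1 <;> ring
      · unfold crE
        simp only [← sub_div]
        rw [div_mul_div_comm, div_mul_div_comm, div_div_div_cancel_right₀ (by positivity)]

lemma lift_int {F : ℝ → ℝ} (hlift : ∀ x : ℝ, F (x + 1) = F x + 1) (m : ℤ) :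
    ∀ x, F (x + m) = F x + m := by
  induction m using Int.induction_on with
  | zero => simp
  | succ i ih => intro x; push_cast at *; rw [← add_assoc, hlift, ih]; ring
  | pred i ih =>
    intro x; push_cast at *
    have := hlift (x + (-(i:ℝ) - 1))
    rw [show x + (-(i:ℝ) - 1) + 1 = x + -(i:ℝ) by ring, ih] at this
    linarith

lemma deriv_int {F : ℝ → ℝ} (hlift : ∀ x : ℝ, F (x + 1) = F x + 1) (m : ℤ) (x : ℝ) :
    deriv F (x + m) = deriv F x := by
  have : (fun y => F (y + m)) = fun y => F y + m := funext (lift_int hlift m)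
  rw [← deriv_comp_add_const, this, deriv_add_const]

lemma lemA (F : ℝ → ℝ) (hA : ∀ x : ℝ, AnalyticAt ℝ F x) (hmono : StrictMono F)
    (hlift : ∀ x : ℝ, F (x + 1) = F x + 1) :
    ∃ c0 > 0, ∀ x z y, x ≤ z → z ≤ y → y ≤ x + 1 → c0 * deriv F z * (y - x) ≤ F y - F x := by
  have hd0 : ∀ x, 0 ≤ deriv F x := fun x => hmono.monotone.deriv_nonneg
  have hcont : Continuous F := continuous_iff_continuousAt.2 fun x => (hA x).continuousAt
  have hdcont : Continuous (deriv F) :=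
    continuous_iff_continuousAt.2 fun x => (hA x).deriv.continuousAt
  have step1 : ∃ ε > 0, ∃ c0 > 0, ∀ x ∈ Icc (0:ℝ) 1, ∀ z y, x ≤ z → z ≤ y → y < x + ε →
      c0 * deriv F z * (y - x) ≤ F y - F x := by
    refine isCompact_Icc.induction_on (p := fun S => ∃ ε > 0, ∃ c0 > 0, ∀ x ∈ S, ∀ z y, x ≤ z →
      z ≤ y → y < x + ε → c0 * deriv F z * (y - x) ≤ F y - F x) ?_ ?_ ?_ ?_
    · exact ⟨1, one_pos, 1, one_pos, by simp⟩
    · rintro s t hst ⟨ε, hε, c0, hc0, h⟩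
      exact ⟨ε, hε, c0, hc0, fun x hx => h x (hst hx)⟩
    · rintro s t ⟨ε, hε, c0, hc0, h⟩ ⟨ε', hε', c0', hc0', h'⟩
      refine ⟨min ε ε', lt_min hε hε', min c0 c0', lt_min hc0 hc0', ?_⟩
      intro x hx z y hxz hzy hy
      have hy1 := hy.trans_le (add_le_add_right (min_le_left ε ε') x)
      have hy2 := hy.trans_le (add_le_add_right (min_le_right ε ε') x)
      have hn : 0 ≤ deriv F z * (y - x) := mul_nonneg (hd0 z) (by linarith)
      rcases hx with hx | hx
      · have := h x hx z y hxz hzy hy1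
        have := mul_le_mul_of_nonneg_right (min_le_left c0 c0') hn
        linarith
      · have := h' x hx z y hxz hzy hy2
        have := mul_le_mul_of_nonneg_right (min_le_right c0 c0') hn
        linarith
    · intro c _
      obtain ⟨ε, hε, c0, hc0, h⟩ := lemA_local F hA hmono c
      refine ⟨Metric.ball c (ε/2), mem_nhdsWithin_of_mem_nhds (Metric.ball_mem_nhds _ (by linarith)),
        ε/2, by linarith, c0, hc0, ?_⟩
      intro x hx z y hxz hzy hy
      rw [Metric.mem_ball, Real.dist_eq, abs_lt] at hx
      apply h x z y _ _ hxz hzy <;> rw [abs_lt] <;> constructor <;> linarith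
  obtain ⟨ε, hε, c0, hc0, h⟩ := step1
  -- all x
  have step2 : ∀ x z y, x ≤ z → z ≤ y → y < x + ε → c0 * deriv F z * (y - x) ≤ F y - F x := by
    intro x z y hxz hzy hy
    have := h (x + (-⌊x⌋ : ℤ)) ⟨?_, ?_⟩ (z + (-⌊x⌋ : ℤ)) (y + (-⌊x⌋ : ℤ)) (by linarith) (by linarith)
      (by linarith)
    · rw [deriv_int hlift, lift_int hlift, lift_int hlift] at this
      linarith
    · push_cast; linarith [Int.floor_le x]
    · push_cast; linarith [Int.lt_floor_add_one x]
  obtain ⟨zm, -, hzm⟩ := isCompact_Icc.exists_isMaxOn (nonempty_Icc.2 (zero_le_one' ℝ)) hdcont.continuousOn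
  obtain ⟨xm, -, hxm⟩ := isCompact_Icc.exists_isMinOn (nonempty_Icc.2 (zero_le_one' ℝ))
    (f := fun x => F (x + ε) - F x) (by fun_prop)
  have B : ∀ z, deriv F z ≤ deriv F zm := by
    intro z
    have := hzm (show z + (-⌊z⌋ : ℤ) ∈ Icc (0:ℝ) 1 from ⟨?_, ?_⟩)
    · simpa only [mem_ofPred_eq, deriv_int hlift] using this
    · push_cast; linarith [Int.floor_le z]
    · push_cast; linarith [Int.lt_floor_add_one z]
  have D : ∀ x, F (xm + ε) - F xm ≤ F (x + ε) - F x := by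
    intro z
    have := hxm (show z + (-⌊z⌋ : ℤ) ∈ Icc (0:ℝ) 1 from ⟨?_, ?_⟩)
    · simp only [mem_ofPred_eq] at this
      rw [show z + ((-⌊z⌋ : ℤ) : ℝ) + ε = z + ε + ((-⌊z⌋ : ℤ) : ℝ) by ring, lift_int hlift, lift_int hlift] at this
      linarith
    · push_cast; linarith [Int.floor_le z]
    · push_cast; linarith [Int.lt_floor_add_one z]
  set δ := F (xm + ε) - F xm
  have hδ : 0 < δ := sub_pos.2 (hmono (by linarith))
  set M := deriv F zm + 1
  have hM : 0 < M := by have := hd0 zm; positivity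
  refine ⟨min c0 (δ / M), lt_min hc0 (div_pos hδ hM), ?_⟩
  intro x z y hxz hzy hy
  have hn : 0 ≤ deriv F z * (y - x) := mul_nonneg (hd0 z) (by linarith)
  rcases lt_or_ge y (x + ε) with hlt | hge
  · have := step2 x z y hxz hzy hlt
    have := mul_le_mul_of_nonneg_right (min_le_left c0 (δ/M)) hn
    linarith
  · have h1 := mul_le_mul_of_nonneg_right (min_le_right c0 (δ/M)) hn
    have h2 : deriv F z * (y - x) ≤ M * 1 := by
      apply mul_le_mul _ (by linarith) (by linarith) hM.le
      have := B z; show _ ≤ deriv F zm + 1; linarith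
    have h3 : δ / M * (deriv F z * (y - x)) ≤ δ / M * (M * 1) := by gcongr
    have h4 : δ / M * (M * 1) = δ := by field_simp
    have h5 := D x
    have h6 := hmono.monotone hge
    linarith

lemma lemA_cr (F : ℝ → ℝ) (hA : ∀ x : ℝ, AnalyticAt ℝ F x) (hmono : StrictMono F)
    (hlift : ∀ x : ℝ, F (x + 1) = F x + 1) :
    ∃ Λ ≥ 0, ∀ a b c d, a < b → b < c → c < d → d ≤ a + 1 → 
      Real.exp (-Λ) * crE a b c d ≤ crE (F a) (F b) (F c) (F d) := by
  obtain ⟨c0, hc0, h⟩ := lemA F hA hmono hlift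
  have hdiff : Differentiable ℝ F := fun x => (hA x).differentiableAt
  have key : ∀ x y u v, x ≤ u → u < v → v ≤ y → y ≤ x + 1 → 
      c0 * (F v - F u) * (y - x) ≤ (F y - F x) * (v - u) := by
    intro x y u v hxu huv hvy hyx
    obtain ⟨ξ, hξ, e⟩ := exists_deriv_eq_slope F huv
      hdiff.continuous.continuousOn hdiff.differentiableOn
    rw [eq_div_iff (by linarith)] at e
    have := h x ξ y (by linarith [hξ.1]) (by linarith [hξ.2]) hyx
    rw [← e]
    have := mul_le_mul_of_nonneg_right this (show 0 ≤ v - u by linarith)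
    linarith
  refine ⟨|Real.log (c0^2)|, abs_nonneg _, ?_⟩
  intro a b c d hab hbc hcd hda
  have hc : Real.exp (-|Real.log (c0^2)|) ≤ c0^2 := by
    calc _ ≤ Real.exp (Real.log (c0^2)) := Real.exp_le_exp.2 (neg_abs_le _)
      _ = _ := Real.exp_log (by positivity)
  refine (mul_le_mul_of_nonneg_right hc (crE_pos hab hbc hcd).le).trans ?_
  have k1 := key a c a b le_rfl hab hbc.le (by linarith)
  have k2 := key b d c d hbc.le hcd le_rfl (by linarith)
  have p1 : 0 < F b - F a := sub_pos.2 (hmono hab)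
  have p2 : 0 < F d - F c := sub_pos.2 (hmono hcd)
  have p3 : 0 < F c - F a := sub_pos.2 (hmono (by linarith))
  have q1 : 0 < b - a := sub_pos.2 hab
  have q2 : 0 < d - c := sub_pos.2 hcd
  have q3 : 0 < c - a := by linarith
  have q4 : 0 < d - b := by linarith
  unfold crE
  rw [← mul_div_assoc, div_le_div_iff₀ (by positivity) (by positivity)]
  have := mul_le_mul k1 k2 (by positivity) (by positivity)
  calc _ = c0 * (F b - F a) * (c - a) * (c0 * (F d - F c) * (d - b)) := by ring
    _ ≤ _ := this
    _ = _ := by ring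

lemma exists_Phi (F : ℝ → ℝ) (hA : ∀ x : ℝ, AnalyticAt ℝ F x) (hmono : StrictMono F)
    (hlift : ∀ x : ℝ, F (x + 1) = F x + 1) :
    ∃ (Φ : ℝ → ℝ) (V : ℝ), Monotone Φ ∧ (∀ x, Φ (x + 1) = Φ x + V) ∧
      ∀ a b c d, a < b → b < c → c < d → d ≤ a + 1 → 
      Real.exp (-(Φ d - Φ a)) * crE a b c d ≤ crE (F a) (F b) (F c) (F d) := by
  obtain ⟨Λ, hΛ, hAc⟩ := lemA_cr F hA hmono hlift
  have step1 : ∃ ε > 0, ∃ (Φ : ℝ → ℝ) (V : ℝ), Monotone Φ ∧ (∀ x, Φ (x + 1) = Φ x + V) ∧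
      ∀ a ∈ Icc (0:ℝ) 1, ∀ b c d, a < b → b < c → c < d → d ≤ a + 1 → d < a + ε →
      Real.exp (-(Φ d - Φ a)) * crE a b c d ≤ crE (F a) (F b) (F c) (F d) := by
    refine isCompact_Icc.induction_on (p := fun S => ∃ ε > 0, ∃ (Φ : ℝ → ℝ) (V : ℝ), Monotone Φ ∧
      (∀ x, Φ (x + 1) = Φ x + V) ∧
      ∀ a ∈ S, ∀ b c d, a < b → b < c → c < d → d ≤ a + 1 → d < a + ε →
      Real.exp (-(Φ d - Φ a)) * crE a b c d ≤ crE (F a) (F b) (F c) (F d)) ?_ ?_ ?_ ?_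
    · exact ⟨1, one_pos, fun x => 0, 0, monotone_const, by simp⟩
    · rintro s t hst ⟨ε, hε, Φ, V, h1, h2, h⟩
      exact ⟨ε, hε, Φ, V, h1, h2, fun x hx => h x (hst hx)⟩
    · rintro s t ⟨ε, hε, Φ, V, h1, h2, h⟩ ⟨ε', hε', Φ', V', h1', h2', h'⟩
      refine ⟨min ε ε', lt_min hε hε', fun x => Φ x + Φ' x, V + V', h1.add h1', ?_, ?_⟩
      · intro x; simp only [h2, h2']; ring
      intro a ha b c d hab hbc hcd hda hd
      have hy1 := hd.trans_le (add_le_add_right (min_le_left ε ε') a)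
      have hy2 := hd.trans_le (add_le_add_right (min_le_right ε ε') a)
      have m1 := h1 (show a ≤ d by linarith)
      have m2 := h1' (show a ≤ d by linarith)
      have hp := (crE_pos hab hbc hcd).le
      rcases ha with hx | hx
      · refine le_trans ?_ (h a hx b c d hab hbc hcd hda hy1)
        gcongr ?_ * _
        apply Real.exp_le_exp.2; linarith
      · refine le_trans ?_ (h' a hx b c d hab hbc hcd hda hy2)
        gcongr ?_ * _
        apply Real.exp_le_exp.2; linarith
    · intro o _
      obtain ⟨ε, hε, K, hK, h⟩ := lemB_local F hA hmono o
      refine ⟨Metric.ball o (ε/2), mem_nhdsWithin_of_mem_nhds (Metric.ball_mem_nhds _ (by linarith)),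
        ε/2, by linarith, fun x => K * x + Λ * ⌈x - o⌉, K + Λ, ?_, ?_, ?_⟩
      · intro x y hxy
        have : ⌈x - o⌉ ≤ ⌈y - o⌉ := Int.ceil_mono (by linarith)
        have : (⌈x - o⌉ : ℝ) ≤ ⌈y - o⌉ := by exact_mod_cast this
        show K * x + Λ * ⌈x - o⌉ ≤ K * y + Λ * ⌈y - o⌉
        gcongr
      · intro x
        show K * (x + 1) + Λ * ⌈x + 1 - o⌉ = _
        rw [show x + 1 - o = (x - o) + 1 by ring, Int.ceil_add_one]
        push_cast; ring
      intro a ha b c d hab hbc hcd hda hd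
      rw [Metric.mem_ball, Real.dist_eq, abs_lt] at ha
      have hp := (crE_pos hab hbc hcd).le
      have hceil : (⌈a - o⌉ : ℝ) ≤ ⌈d - o⌉ := by
        exact_mod_cast Int.ceil_mono (by linarith)
      by_cases hor : d ≤ o ∨ o ≤ a
      · refine le_trans ?_ (h a b c d (by rw [abs_lt]; constructor <;> linarith)
          (by rw [abs_lt]; constructor <;> linarith) hab hbc hcd hor)
        gcongr ?_ * _
        apply Real.exp_le_exp.2
        have := mul_le_mul_of_nonneg_left hceil hΛ
        linarith
      · push Not at hor
        refine le_trans ?_ (hAc a b c d hab hbc hcd hda)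
        gcongr ?_ * _
        apply Real.exp_le_exp.2
        have c1 : ⌈a - o⌉ ≤ 0 := Int.ceil_le.2 (by push_cast; linarith [hor.2])
        have c2 : 1 ≤ ⌈d - o⌉ := by
          have : 0 < ⌈d - o⌉ := Int.ceil_pos.2 (by linarith [hor.1])
          omega
        have c3 : (1:ℝ) ≤ ⌈d - o⌉ - ⌈a - o⌉ := by exact_mod_cast (by omega : 1 ≤ ⌈d - o⌉ - ⌈a - o⌉)
        have c4 := mul_le_mul_of_nonneg_left c3 hΛ
        have c5 : 0 ≤ K * (d - a) := mul_nonneg hK (by linarith)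
        linarith
  obtain ⟨ε, hε, Φ, V, hm, hV, h⟩ := step1
  have hVi : ∀ (m : ℤ) x, Φ (x + m) = Φ x + m * V := by
    intro m
    induction m using Int.induction_on with
    | zero => simp
    | succ i ih => intro x; push_cast at *; rw [← add_assoc, hV, ih]; ring
    | pred i ih =>
      intro x; push_cast at *
      have := hV (x + (-(i:ℝ) - 1))
      rw [show x + (-(i:ℝ) - 1) + 1 = x + -(i:ℝ) by ring, ih] at this
      linarith
  refine ⟨fun x => Φ x + Λ / ε * x, V + Λ / ε, ?_, ?_, ?_⟩
  · intro x y hxy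
    show Φ x + Λ / ε * x ≤ Φ y + Λ / ε * y
    have := hm hxy
    gcongr
  · intro x
    show Φ (x + 1) + Λ / ε * (x + 1) = _
    rw [hV]; ring
  intro a b c d hab hbc hcd hda
  have hp := (crE_pos hab hbc hcd).le
  have hmm := hm (show a ≤ d by linarith)
  rcases lt_or_ge d (a + ε) with hlt | hge
  · have := h (a + (-⌊a⌋ : ℤ)) ⟨?_, ?_⟩ (b + (-⌊a⌋ : ℤ)) (c + (-⌊a⌋ : ℤ)) (d + (-⌊a⌋ : ℤ))
      (by linarith) (by linarith) (by linarith) (by linarith) (by linarith)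
    · simp only [lift_int hlift, hVi] at this
      have e : ∀ x y z w t : ℝ, crE (x + t) (y + t) (z + t) (w + t) = crE x y z w := by
        intros; unfold crE; simp only [add_sub_add_right_eq_sub]
      rw [e, e, add_sub_add_right_eq_sub] at this
      refine le_trans ?_ this
      gcongr ?_ * _
      apply Real.exp_le_exp.2
      have : 0 ≤ Λ / ε * (d - a) := mul_nonneg (by positivity) (by linarith)
      linarith
    · push_cast; linarith [Int.floor_le a]
    · push_cast; linarith [Int.lt_floor_add_one a]
  · refine le_trans ?_ (hAc a b c d hab hbc hcd hda)
    gcongr ?_ * _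
    apply Real.exp_le_exp.2
    have : Λ / ε * ε ≤ Λ / ε * (d - a) := by gcongr; linarith
    have : Λ / ε * ε = Λ := by field_simp
    linarith

lemma sum_le_aux {ι : Type*} [DecidableEq ι] (u v : ι → ℝ) (Φ : ℝ → ℝ) (hΦ : Monotone Φ) (A : ℝ)
    (s : Finset ι) :
    ∀ B, A ≤ B → (∀ i ∈ s, A ≤ u i ∧ u i < v i ∧ v i ≤ B) →
    (∀ i ∈ s, ∀ j ∈ s, i ≠ j → ¬ (u i < v j ∧ u j < v i)) →
    ∑ i ∈ s, (Φ (v i) - Φ (u i)) ≤ Φ B - Φ A := by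
  induction s using Finset.induction_on_max_value u with
  | empty => intro B hAB _ _; simpa using hΦ hAB
  | insert a s ha hmax ih =>
    intro B hAB h1 h2
    rw [Finset.sum_insert ha]
    have h3 := h1 a (Finset.mem_insert_self _ _)
    have := ih (u a) h3.1 (fun i hi => ?_) (fun i hi j hj => h2 i (Finset.mem_insert_of_mem hi) j
      (Finset.mem_insert_of_mem hj))
    · have := hΦ h3.2.2
      linarith
    · have h4 := h1 i (Finset.mem_insert_of_mem hi)
      refine ⟨h4.1, h4.2.1, ?_⟩
      by_contra hlt
      push Not at hlt
      exact h2 i (Finset.mem_insert_of_mem hi) a (Finset.mem_insert_self _ _)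
        (fun e => ha (e ▸ hi)) ⟨by linarith [hmax i hi], hlt⟩

lemma Phi_int {Φ : ℝ → ℝ} {V : ℝ} (hV : ∀ x, Φ (x + 1) = Φ x + V) :
    ∀ (m : ℤ) x, Φ (x + m) = Φ x + m * V := by
  intro m
  induction m using Int.induction_on with
  | zero => simp
  | succ i ih => intro x; push_cast at *; rw [← add_assoc, hV, ih]; ring
  | pred i ih =>
    intro x; push_cast at *
    have := hV (x + (-(i:ℝ) - 1))
    rw [show x + (-(i:ℝ) - 1) + 1 = x + -(i:ℝ) by ring, ih] at this
    linarith

lemma sum_circle {ι : Type*} [DecidableEq ι] (u v : ι → ℝ) (Φ : ℝ → ℝ) (hΦ : Monotone Φ) (V : ℝ)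
    (hV : ∀ x, Φ (x + 1) = Φ x + V) (s : Finset ι)
    (h1 : ∀ i ∈ s, u i < v i ∧ v i ≤ u i + 1)
    (h2 : ∀ i ∈ s, ∀ j ∈ s, i ≠ j → ∀ m : ℤ, ¬ (u i + m < v j ∧ u j < v i + m)) :
    ∑ i ∈ s, (Φ (v i) - Φ (u i)) ≤ V := by
  rcases s.eq_empty_or_nonempty with rfl | hne
  · have := hΦ (show (0:ℝ) ≤ 0 + 1 by norm_num)
    rw [hV] at this
    simp; linarith
  let u' : ι → ℝ := fun i => u i + (-⌊u i⌋ : ℤ)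
  let v' : ι → ℝ := fun i => v i + (-⌊u i⌋ : ℤ)
  have hu0 : ∀ i, 0 ≤ u' i := fun i => by
    simp only [u']; push_cast; linarith [Int.floor_le (u i)]
  have hu1 : ∀ i, u' i < 1 := fun i => by
    simp only [u']; push_cast; linarith [Int.lt_floor_add_one (u i)]
  have e : ∑ i ∈ s, (Φ (v i) - Φ (u i)) = ∑ i ∈ s, (Φ (v' i) - Φ (u' i)) := by
    refine Finset.sum_congr rfl fun i _ => ?_
    simp only [u', v', Phi_int hV]; ring
  have h1' : ∀ i ∈ s, u' i < v' i ∧ v' i ≤ u' i + 1 := fun i hi => by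
    have := h1 i hi
    simp only [u', v']; constructor <;> linarith
  have h2' : ∀ i ∈ s, ∀ j ∈ s, i ≠ j → ∀ m : ℤ, ¬ (u' i + m < v' j ∧ u' j < v' i + m) := by
    intro i hi j hj hij m hh
    apply h2 i hi j hj hij (m - ⌊u i⌋ + ⌊u j⌋)
    simp only [u', v'] at hh
    push_cast at *
    constructor <;> linarith
  obtain ⟨i0, hi0, hmin⟩ := s.exists_min_image u' hne
  rw [e]
  have := sum_le_aux u' v' Φ hΦ (u' i0) s (u' i0 + 1) (by linarith) (fun i hi => ?_)
    (fun i hi j hj hij hh => ?_)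
  · rw [hV] at this; linarith
  · refine ⟨hmin i hi, (h1' i hi).1, ?_⟩
    by_cases hii : i0 = i
    · subst hii; exact (h1' _ hi).2
    by_contra hlt
    push Not at hlt
    apply h2' i0 hi0 i hi hii 1
    push_cast
    exact ⟨hlt, by linarith [hu1 i, hu0 i0, (h1' i0 hi0).1]⟩
  · apply h2' i hi j hj hij 0
    simpa using hh

lemma exists_semiconj (F : ℝ → ℝ) (hcont : Continuous F) (hmono : StrictMono F)
    (hlift : ∀ x : ℝ, F (x + 1) = F x + 1)
    (hnoper : ∀ x : ℝ, ∀ n : ℕ, 1 ≤ n → ∀ m : ℤ, F^[n] x ≠ x + (m : ℝ)) :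
    Function.Surjective F ∧ 
    ∃ (α : ℝ) (h : ℝ → ℝ), Irrational α ∧ Monotone h ∧ Continuous h ∧ Function.Surjective h ∧
      (∀ x, h (x + 1) = h x + 1) ∧ ∀ x, h (F x) = h x + α := by
  have surj : ∀ G : ℝ → ℝ, Continuous G → (∀ x, G (x + 1) = G x + 1) → Function.Surjective G := by
    intro G hG hl y
    have i1 : G 0 + ((⌊y - G 0⌋ : ℤ) : ℝ) ≤ y := by linarith [Int.floor_le (y - G 0)]
    have i2 : y ≤ G 0 + ((⌊y - G 0⌋ + 1 : ℤ) : ℝ) := by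
      push_cast; linarith [Int.lt_floor_add_one (y - G 0)]
    rw [← lift_int hl] at i1 i2
    obtain ⟨x, -, hx⟩ := intermediate_value_Icc (show (0 + ((⌊y - G 0⌋ : ℤ) : ℝ)) ≤ 0 + ((⌊y - G 0⌋ + 1 : ℤ) : ℝ) by push_cast; linarith)
      hG.continuousOn ⟨i1, i2⟩
    exact ⟨x, hx⟩
  have hs := surj F hcont hlift
  refine ⟨hs, ?_⟩
  let f : CircleDeg1Lift := ⟨⟨F, hmono.monotone⟩, hlift⟩
  have hfF : (f : ℝ → ℝ) = F := rfl
  set α := CircleDeg1Lift.translationNumber f with hα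
  obtain ⟨H, hH⟩ := CircleDeg1Lift.semiconj_of_bijective_of_translationNumber_eq (f₁ := f)
    (f₂ := (CircleDeg1Lift.translate (Multiplicative.ofAdd α) : CircleDeg1Lift))
    ⟨hmono.injective, hs⟩
    (by
      constructor
      · intro x y hxy; simpa using hxy
      · intro y; exact ⟨y - α, by simp⟩)
    (by rw [CircleDeg1Lift.translationNumber_translate])
  have hsemi : ∀ x, H (F x) = H x + α := by
    intro x
    have := hH x
    simp only [hfF] at this
    rw [this]; simp [add_comm]
  have hirr : Irrational α := by
    rintro ⟨r, hr⟩
    have : α = (r.num : ℝ) / (r.den : ℝ) := by rw [← hr]; exact_mod_cast (Rat.num_div_den r).symm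
    rw [hα] at this
    obtain ⟨x, hx⟩ := (CircleDeg1Lift.translationNumber_eq_rat_iff f hcont r.pos).1 this
    rw [CircleDeg1Lift.coe_pow] at hx
    exact hnoper x r.den r.pos r.num hx
  have hHl : ∀ x, H (x + 1) = H x + 1 := H.map_add_one
  have hHi := lift_int hHl
  have hz : ∀ (n : ℤ), ∃ x, H x = H 0 + n * α := by
    intro n
    induction n using Int.induction_on with
    | zero => exact ⟨0, by simp⟩
    | succ i ih => obtain ⟨x, hx⟩ := ih; exact ⟨F x, by rw [hsemi, hx]; push_cast; ring⟩
    | pred i ih =>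
      obtain ⟨x, hx⟩ := ih
      obtain ⟨y, rfl⟩ := hs x
      rw [hsemi] at hx
      exact ⟨y, by push_cast at *; linarith⟩
  have hdense : DenseRange H := by
    have hd := (dense_addSubgroupClosure_pair_iff (a := α) (b := 1)).2 (by simpa using hirr)
    have hd2 : Dense ((fun x => H 0 + x) '' (AddSubgroup.closure {α, 1} : Set ℝ)) :=
      (Homeomorph.addLeft (H 0)).surjective.denseRange.dense_image (Homeomorph.addLeft (H 0)).continuous hd
    refine hd2.mono ?_
    rintro _ ⟨x, hx, rfl⟩
    obtain ⟨n, m, rfl⟩ := AddSubgroup.mem_closure_pair.1 hx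
    obtain ⟨y, hy⟩ := hz n
    refine ⟨y + m, ?_⟩
    rw [hHi, hy]; simp; ring
  have hHc : Continuous H := H.monotone.continuous_of_denseRange hdense
  exact ⟨α, H, hirr, H.monotone, hHc, surj H hHc hHl, hHl, hsemi⟩

lemma rot (α : ℝ) (hirr : Irrational α) (ℓ : ℕ → ℝ) (hpos : ∀ i, 0 < ℓ i)
    (hlim : Tendsto ℓ atTop (𝓝 0)) (δ : ℝ) (hδ : 0 < δ) :
    ∃ (n Q : ℕ) (η : ℝ), 0 < η ∧ η < δ ∧ n < Q ∧ (∀ i < Q, ℓ n ≤ ℓ i) ∧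
      (∀ i < Q, ∀ j < Q, i ≠ j → ∀ m : ℤ, η ≤ |(i:ℝ) * α - j * α + m|) ∧
      (∃ l < Q, ∃ m : ℤ, -(2*η) ≤ l * α + m - n * α ∧ l * α + m - n * α < 0) ∧
      (∃ r < Q, ∃ m : ℤ, 0 < r * α + m - n * α ∧ r * α + m - n * α ≤ 2*η) := by
  set dd : ℕ → ℝ := fun j => |(j:ℝ) * α - round ((j:ℝ) * α)| with hdd
  have ddpos : ∀ j, 1 ≤ j → 0 < dd j := by
    intro j hj
    refine abs_pos.2 (sub_ne_zero.2 ?_)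
    exact (hirr.natCast_mul (by omega : j ≠ 0)).ne_int _
  have dir : ∀ t > 0, ∃ k, 1 ≤ k ∧ dd k < t := by
    intro t ht
    obtain ⟨N, hN⟩ := exists_nat_one_div_lt ht
    obtain ⟨k, hk, -, h⟩ := Real.exists_nat_abs_mul_sub_round_le α (n := N + 1) (by omega)
    refine ⟨k, hk, h.trans_lt (lt_of_le_of_lt ?_ hN)⟩
    push_cast
    apply one_div_le_one_div_of_le <;> linarith [(Nat.cast_nonneg N : (0:ℝ) ≤ N)]
  obtain ⟨k0, hk0, hk0d⟩ := dir δ hδ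
  obtain ⟨i0, hi0⟩ : ∃ i0, ∀ j ∈ Finset.range (k0 + 1), ℓ i0 < ℓ j := by
    have : ∀ᶠ i in atTop, ∀ j ∈ Finset.range (k0+1), ℓ i < ℓ j := by
      rw [Filter.eventually_all_finset]
      intro j _
      exact hlim.eventually_lt_const (hpos j)
    exact this.exists
  have hex : ∃ q, 1 ≤ q ∧ ∀ j ∈ Finset.Icc 1 (max 1 i0), dd q < dd j := by
    obtain ⟨j0, hj0, hmin⟩ := (Finset.Icc 1 (max 1 i0)).exists_min_image dd
      ⟨1, by simp⟩
    obtain ⟨q, hq, hqd⟩ := dir (dd j0) (ddpos _ (Finset.mem_Icc.1 hj0).1)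
    exact ⟨q, hq, fun j hj => hqd.trans_le (hmin j hj)⟩
  classical
  set q' := Nat.find hex with hq'
  obtain ⟨hq'1, hq'2⟩ := Nat.find_spec hex
  have hq'3 : ∀ j, 1 ≤ j → j < q' → dd q' < dd j := by
    intro j hj hjq
    have := Nat.find_min hex hjq
    push Not at this
    obtain ⟨j0, hj0, hle⟩ := this hj
    exact (hq'2 j0 hj0).trans_le hle
  have hi0q : i0 < q' := by
    by_contra hcon
    push Not at hcon
    exact lt_irrefl _ (hq'2 q' (Finset.mem_Icc.2 ⟨hq'1, le_max_of_le_right hcon⟩))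
  obtain ⟨n, hn, hnmin⟩ := (Finset.range q').exists_min_image ℓ ⟨i0, Finset.mem_range.2 hi0q⟩
  have hk0n : k0 < n := by
    by_contra hcon
    push Not at hcon
    have h1 := hi0 n (Finset.mem_range.2 (by omega))
    have h2 := hnmin i0 (Finset.mem_range.2 hi0q)
    linarith
  obtain ⟨q, hq, hqmin⟩ := (Finset.Icc 1 n).exists_min_image dd ⟨k0, Finset.mem_Icc.2 ⟨hk0, hk0n.le⟩⟩
  obtain ⟨hq1, hqn⟩ := Finset.mem_Icc.1 hq
  have hnq' := Finset.mem_range.1 hn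
  have hex2 : ∃ i, 1 ≤ i ∧ dd i < dd q := ⟨q', hq'1, hq'3 q hq1 (by omega)⟩
  set Q := Nat.find hex2 with hQ
  obtain ⟨hQ1, hQ2⟩ := Nat.find_spec hex2
  have hQq' : Q ≤ q' := Nat.find_min' hex2 ⟨hq'1, hq'3 q hq1 (by omega)⟩
  have hQ3 : ∀ j, 1 ≤ j → j < Q → dd q ≤ dd j := by
    intro j hj hjq
    have := Nat.find_min hex2 hjq
    push Not at this
    exact this hj
  have hnQ : n < Q := by
    by_contra hcon
    push Not at hcon
    have := hqmin Q (Finset.mem_Icc.2 ⟨hQ1, hcon⟩)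
    linarith
  have sep0 : ∀ i < Q, ∀ j < i, ∀ m : ℤ, dd q ≤ |(i:ℝ) * α - j * α + m| := by
    intro i hi j hj m
    refine (hQ3 (i - j) (by omega) (by omega)).trans ?_
    have := round_le (((i - j : ℕ) : ℝ) * α) (-m)
    refine this.trans (le_of_eq ?_)
    rw [Nat.cast_sub hj.le]; push_cast; congr 1; ring
  have hη : dd q < δ := (hqmin k0 (Finset.mem_Icc.2 ⟨hk0, hk0n.le⟩)).trans_lt hk0d
  set p := round ((q:ℝ) * α) with hp
  set P := round ((Q:ℝ) * α) with hP
  have hlq : (((n - q : ℕ) : ℝ) * α + (p : ℤ) - n * α) = -((q:ℝ) * α - p) := by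
    rw [Nat.cast_sub hqn]; ring
  obtain ⟨s, hs, ms, θ', hse, hθ'⟩ : ∃ s < Q, ∃ ms : ℤ, ∃ θ' : ℝ,
      (s:ℝ) * α + ms - n * α = ((q:ℝ) * α - p) - θ' ∧ |θ'| < dd q := by
    by_cases hc : n + q < Q
    · refine ⟨n + q, hc, -p, 0, by push_cast; ring, by simpa using ddpos q hq1⟩
    · refine ⟨n + q - Q, by omega, P - p, (Q:ℝ) * α - P, ?_, hQ2⟩
      rw [Nat.cast_sub (by omega)]; push_cast; ring
  have hηe : dd q = |(q:ℝ) * α - p| := rfl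
  have hη0 := ddpos q hq1
  refine ⟨n, Q, dd q, hη0, hη, hnQ, fun i hi => hnmin i (Finset.mem_range.2 (by omega)), ?_, ?_⟩
  · intro i hi j hj hij m
    rcases lt_or_gt_of_ne hij with h | h
    · have := sep0 j hj i h (-m)
      rw [← abs_neg]
      refine this.trans (le_of_eq ?_)
      push_cast; congr 1; ring
    · exact sep0 i hi j h m
  have hθ := abs_lt.1 hθ'
  rcases abs_cases ((q:ℝ) * α - p) with ⟨h1, h2⟩ | ⟨h1, h2⟩
  · exact ⟨⟨n - q, by omega, p, by rw [hlq]; linarith, by rw [hlq]; linarith⟩,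
      ⟨s, hs, ms, by rw [hse]; linarith, by rw [hse]; linarith⟩⟩
  · exact ⟨⟨s, hs, ms, by rw [hse]; linarith, by rw [hse]; linarith⟩,
      ⟨n - q, by omega, p, by rw [hlq]; linarith, by rw [hlq]; linarith⟩⟩

lemma main_aux (F : ℝ → ℝ) (hA : ∀ x : ℝ, AnalyticAt ℝ F x) (hmono : StrictMono F)
    (hlift : ∀ x : ℝ, F (x + 1) = F x + 1) (hsurj : Function.Surjective F)
    (α : ℝ) (h : ℝ → ℝ) (hirr : Irrational α) (hm : Monotone h) (hhs : Function.Surjective h)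
    (hl : ∀ x, h (x + 1) = h x + 1) (hF : ∀ x, h (F x) = h x + α)
    (a b : ℝ) (hab : a < b) (hh : h a = h b) (hinf : ∀ x < a, h x < h a) : False := by
  obtain ⟨Φ, V, hΦ, hV, hcr⟩ := exists_Phi F hA hmono hlift
  have hit : ∀ (n : ℕ) x, h (F^[n] x) = h x + n * α := by
    intro n
    induction n with
    | zero => simp
    | succ n ih => intro x; rw [Function.iterate_succ_apply', hF, ih]; push_cast; ring
  have hli := lift_int hl
  have hFm : ∀ n, StrictMono (F^[n]) := fun n => hmono.iterate n
  have hFs : ∀ n, Function.Surjective (F^[n]) := fun n => hsurj.iterate n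
  have le1 : ∀ x y, h y < h x + 1 → y ≤ x + 1 := by
    intro x y hxy
    rw [← hl] at hxy
    exact (hm.reflect_lt hxy).le
  have irr0 : ∀ i j : ℕ, i ≠ j → ∀ m : ℤ, (i:ℝ) * α + m ≠ j * α := by
    intro i j hij m e
    have h1 : ((i:ℤ) - j : ℤ) ≠ 0 := by omega
    apply (hirr.intCast_mul h1).ne_int (-m)
    push_cast; linarith
  set ℓ : ℕ → ℝ := fun i => F^[i] b - F^[i] a with hℓ
  have hℓpos : ∀ i, 0 < ℓ i := fun i => sub_pos.2 (hFm i hab)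
  have hℓlim : Tendsto ℓ atTop (𝓝 0) := by
    refine (summable_of_sum_range_le (c := 1) (fun i => (hℓpos i).le) fun N => ?_).tendsto_atTop_zero
    refine sum_circle (fun i => F^[i] a) (fun i => F^[i] b) (fun x => x) monotone_id 1 (fun x => rfl)
      (Finset.range N) (fun i _ => ⟨hFm i hab, le1 _ _ (by rw [hit, hit, hh]; linarith)⟩) ?_
    rintro i - j - hij m ⟨h1, h2⟩
    have h1 := hm h1.le
    have h2 := hm h2.le
    simp only [hli, hit, hh] at h1 h2
    exact irr0 i j hij m (by linarith)
  set δ0 := (b - a) / (4 * Real.exp (10 * V)) with hδ0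
  have hδ0p : 0 < δ0 := div_pos (by linarith) (by positivity)
  have hgap := hinf (a - δ0) (by linarith)
  obtain ⟨n, Q, η, hη0, hηδ, hnQ, hmin, hsep, ⟨l, hlQ, ml, hl1, hl2⟩, ⟨r, hrQ, mr, hr1, hr2⟩⟩ :=
    rot α hirr ℓ hℓpos hℓlim (min (1/8) ((h a - h (a - δ0))/2)) (lt_min (by norm_num) (by linarith))
  have hη8 : η < 1/8 := hηδ.trans_le (min_le_left _ _)
  have hηg : 2 * η < h a - h (a - δ0) := by
    have := hηδ.trans_le (min_le_right _ _); linarith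
  obtain ⟨A, hAe⟩ := hFs n (F^[l] a + ml)
  obtain ⟨D, hDe⟩ := hFs n (F^[r] b + mr)
  have hhA : h A = h a + (l * α + ml - n * α) := by
    have := congrArg h hAe
    rw [hit, hli, hit] at this; linarith
  have hhD : h D = h a + (r * α + mr - n * α) := by
    have := congrArg h hDe
    rw [hit, hli, hit, ← hh] at this; linarith
  have hAa : A < a := hm.reflect_lt (by linarith)
  have hbD : b < D := hm.reflect_lt (by linarith)
  -- distortion
  have hdist : ∀ i, Real.exp (-∑ j ∈ Finset.range i, (Φ (F^[j] D) - Φ (F^[j] A))) * crE A a b D ≤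
      crE (F^[i] A) (F^[i] a) (F^[i] b) (F^[i] D) := by
    intro i
    induction i with
    | zero => simp
    | succ i ih =>
      have := hcr (F^[i] A) (F^[i] a) (F^[i] b) (F^[i] D) (hFm i hAa) (hFm i hab) (hFm i hbD)
        (le1 _ _ (by rw [hit, hit]; linarith))
      simp only [Function.iterate_succ_apply']
      refine le_trans ?_ this
      rw [Finset.sum_range_succ, neg_add_rev, Real.exp_add, mul_assoc]
      gcongr
  choose y hy using fun k : ℕ => hhs (h a + ((k:ℝ) - 5) * (η / 2))
  have hyA : y 0 < A := hm.reflect_lt (by rw [hy]; push_cast; linarith)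
  have hyD : D < y 10 := hm.reflect_lt (by rw [hy]; push_cast; linarith)
  have hsum : ∑ j ∈ Finset.range n, (Φ (F^[j] D) - Φ (F^[j] A)) ≤ 10 * V := by
    calc ∑ j ∈ Finset.range n, (Φ (F^[j] D) - Φ (F^[j] A)) 
        ≤ ∑ j ∈ Finset.range n, (Φ (F^[j] (y 10)) - Φ (F^[j] (y 0))) := by
          refine Finset.sum_le_sum fun j _ => ?_
          have := hΦ ((hFm j).monotone hyA.le)
          have := hΦ ((hFm j).monotone hyD.le)
          linarith
      _ = ∑ j ∈ Finset.range n, ∑ k ∈ Finset.range 10, (Φ (F^[j] (y (k+1))) - Φ (F^[j] (y k))) := by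
          refine Finset.sum_congr rfl fun j _ => ?_
          rw [Finset.sum_range_sub (fun k => Φ (F^[j] (y k)))]
      _ = ∑ k ∈ Finset.range 10, ∑ j ∈ Finset.range n, (Φ (F^[j] (y (k+1))) - Φ (F^[j] (y k))) :=
          Finset.sum_comm
      _ ≤ ∑ k ∈ Finset.range 10, V := by
          refine Finset.sum_le_sum fun k _ => ?_
          refine sum_circle (fun j => F^[j] (y k)) (fun j => F^[j] (y (k+1))) Φ hΦ V hV
            (Finset.range n) (fun i _ => ⟨hFm i (hm.reflect_lt ?_), le1 _ _ ?_⟩) ?_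
          · rw [hy, hy]; push_cast; linarith
          · rw [hit, hit, hy, hy]; push_cast; linarith
          · rintro i hi j hj hij m ⟨h1, h2⟩
            have hi := Finset.mem_range.1 hi
            have hj := Finset.mem_range.1 hj
            have h1 := hm h1.le
            have h2 := hm h2.le
            simp only [hli, hit, hy] at h1 h2
            push_cast at h1 h2
            have h3 := hsep i (by omega) j (by omega) hij m
            have h4 : |(i:ℝ) * α - j * α + m| ≤ η / 2 := by
              rw [abs_le]; constructor <;> linarith
            linarith
      _ = 10 * V := by simp
  have hfin := hdist n
  rw [hAe, hDe] at hfin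
  -- upper bound
  have hL : ℓ n ≤ F^[n] a - (F^[l] a + ml) := by
    have h1 := hmin l hlQ
    have h2 : F^[l] b + ml < F^[n] a := hm.reflect_lt (by rw [hli, hit, hit, ← hh]; linarith)
    simp only [hℓ] at *; linarith
  have hR : ℓ n ≤ (F^[r] b + mr) - F^[n] b := by
    have h1 := hmin r hrQ
    have h2 : F^[n] b < F^[r] a + mr := hm.reflect_lt (by rw [hli, hit, hit, ← hh]; linarith)
    simp only [hℓ] at *; linarith
  have hup : crE (F^[l] a + ml) (F^[n] a) (F^[n] b) (F^[r] b + mr) ≤ 4 := by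
    have hx := hℓpos n
    have hxe : ℓ n = F^[n] b - F^[n] a := rfl
    unfold crE
    rw [div_le_iff₀ (mul_pos (by linarith) (by linarith))]
    have e1 : F^[n] b - (F^[l] a + ml) ≤ 2 * (F^[n] a - (F^[l] a + ml)) := by linarith
    have e2 : F^[r] b + mr - F^[n] a ≤ 2 * (F^[r] b + mr - F^[n] b) := by linarith
    have := mul_le_mul e1 e2 (by linarith) (by linarith)
    linarith
  have hlow : (b - a) / (a - A) ≤ crE A a b D := by
    unfold crE
    have : 0 < a - A := by linarith
    have : 0 < D - b := by linarith
    rw [div_le_div_iff₀ (by positivity) (by positivity)]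
    have : (b - a) * (D - b) ≤ (b - A) * (D - a) :=
      mul_le_mul (by linarith) (by linarith) (by linarith) (by linarith)
    nlinarith
  have hAa' : 0 < a - A := by linarith
  have hE : Real.exp (-(10 * V)) * ((b - a) / (a - A)) ≤ 4 := by
    refine le_trans ?_ (hfin.trans hup)
    apply mul_le_mul (Real.exp_le_exp.2 (by linarith)) hlow (div_nonneg (by linarith) (by linarith))
      (Real.exp_pos _).le
  have hδA : δ0 ≤ a - A := by
    rw [hδ0, div_le_iff₀ (by positivity)]
    rw [Real.exp_neg, ← mul_div_assoc, div_le_iff₀ hAa', inv_mul_le_iff₀ (Real.exp_pos _)] at hE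
    linarith
  have := hm (show A ≤ a - δ0 by linarith)
  linarith

/-- No wandering intervals for analytic circle maps: if `F` is a real-analytic strictly
increasing lift of a circle homeomorphism (`F(x+1) = F(x)+1`) whose induced circle map
has no periodic points, then there is no wandering interval. -/
theorem no_wandering_intervals_analytic_circle
    (F : ℝ → ℝ)
    (hA : ∀ x : ℝ, AnalyticAt ℝ F x)
    (hmono : StrictMono F)
    (hlift : ∀ x : ℝ, F (x + 1) = F x + 1)
    (hnoper : ∀ x : ℝ, ∀ n : ℕ, 1 ≤ n → ∀ m : ℤ, F^[n] x ≠ x + (m : ℝ)) :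
    ¬ ∃ a b : ℝ, a < b ∧ b - a < 1 ∧
      ∀ n : ℕ, 1 ≤ n → ∀ m : ℤ,
        Disjoint (F^[n] '' Set.Ioo a b) ((fun x : ℝ => x + (m : ℝ)) '' Set.Ioo a b) := by
  rintro ⟨a, b, hab, -, hW⟩
  have hcont : Continuous F := continuous_iff_continuousAt.2 fun x => (hA x).continuousAt
  obtain ⟨hsurj, α, h, hirr, hm, hc, hhs, hl, hF⟩ := exists_semiconj F hcont hmono hlift hnoper
  have hit : ∀ (n : ℕ) x, h (F^[n] x) = h x + n * α := by
    intro n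
    induction n with
    | zero => simp
    | succ n ih => intro x; rw [Function.iterate_succ_apply', hF, ih]; push_cast; ring
  have hli := lift_int hl
  have hh : h a = h b := by
    by_contra hne
    have hlt : h a < h b := lt_of_le_of_ne (hm hab.le) hne
    obtain ⟨t, ht⟩ := hhs ((h a + h b)/2)
    obtain ⟨N, hN⟩ := exists_nat_one_div_lt (show 0 < (h b - h a)/2 by linarith)
    obtain ⟨k, hk, -, hd⟩ := Real.exists_nat_abs_mul_sub_round_le α (n := N + 1) (by omega)
    have hd' : |(k:ℝ) * α - round ((k:ℝ) * α)| < (h b - h a)/2 := by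
      refine hd.trans_lt (lt_of_le_of_lt ?_ hN)
      push_cast
      apply one_div_le_one_div_of_le <;> linarith [(Nat.cast_nonneg N : (0:ℝ) ≤ N)]
    rw [abs_lt] at hd'
    set p := round ((k:ℝ) * α)
    have e : F^[k] t + ((-p : ℤ) : ℝ) + (p : ℝ) = F^[k] t := by push_cast; ring
    have hv : h (F^[k] t + ((-p : ℤ) : ℝ)) = h t + (k * α - p) := by
      rw [hli, hit]; push_cast; ring
    refine Set.disjoint_left.1 (hW k hk p) (Set.mem_image_of_mem _ (show t ∈ Set.Ioo a b from ⟨hm.reflect_lt ?_, hm.reflect_lt ?_⟩))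
      ⟨F^[k] t + ((-p : ℤ) : ℝ), ⟨hm.reflect_lt ?_, hm.reflect_lt ?_⟩, e⟩
    · linarith
    · linarith
    · linarith
    · linarith
  have hcomp : IsCompact (h ⁻¹' {h a} ∩ Set.Icc (a - 1) a) :=
    isCompact_Icc.inter_left (isClosed_singleton.preimage hc)
  have hmem := hcomp.sInf_mem ⟨a, rfl, by linarith, le_rfl⟩
  set a' := sInf (h ⁻¹' {h a} ∩ Set.Icc (a - 1) a) with ha'
  have h1 : h a' = h a := hmem.1
  refine main_aux F hA hmono hlift hsurj α h hirr hm hhs hl hF a' b (by linarith [hmem.2.2])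
    (h1.trans hh) ?_
  intro x hx
  refine lt_of_le_of_ne (hm hx.le) fun e => ?_
  have hxa : a - 1 ≤ x := by
    by_contra hcon
    push Not at hcon
    have h2 := hm hcon.le
    have h3 := hl (a - 1)
    rw [sub_add_cancel] at h3
    linarith
  have := csInf_le hcomp.bddBelow (show x ∈ h ⁻¹' {h a} ∩ Set.Icc (a - 1) a from
    ⟨e.trans h1, hxa, by linarith [hmem.2.2]⟩)
  linarith
end
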